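/- arXiv:2508.02985 — 5 statements merged into one kernel-verified Lean document; each statement's English description precedes it below -/
import Mathlib

section
/- For every integer s ≥ 1, every finite locally s-colourable simple graph G on n vertices satisfies χ(G) ≤ max { s+1, ⌊6n/11⌋ }. -/
open SimpleGraph

/-- `σ` is a proper colouring of `G` with colours in `ℕ`. -/
def IsProperColoring {V : Type*} (G : SimpleGraph V) (σ : V → ℕ) : Prop :=
  ∀ ⦃u v : V⦄, G.Adj u v → σ u ≠ σ v

/-- The chromatic number of `G`, as a natural number. -/
noncomputable def chromNum {V : Type*} (G : SimpleGraph V) : ℕ :=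
  sInf {n : ℕ | G.Colorable n}

/-- The discrepancy `φ_σ(G)` of a proper colouring `σ` of `G`: the maximum, over all
induced subgraphs `G[S]` of `G`, of `|σ(S)| - χ(G[S])`. -/
noncomputable def colDisc {V : Type*} (G : SimpleGraph V) (σ : V → ℕ) : ℤ :=
  sSup {z : ℤ | ∃ S : Set V, z = ((σ '' S).ncard : ℤ) - (chromNum (G.induce S) : ℤ)}

/-- The chromatic discrepancy `φ(G)`: the minimum of `φ_σ(G)` over all proper
colourings `σ` of `G`. -/
noncomputable def chromDisc {V : Type*} (G : SimpleGraph V) : ℤ :=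
  sInf {z : ℤ | ∃ σ : V → ℕ, IsProperColoring G σ ∧ z = colDisc G σ}

/-- `G` is locally `s`-colourable: the closed neighbourhood of every vertex induces an
`s`-colourable subgraph. -/
def LocallyColorable {V : Type*} (G : SimpleGraph V) (s : ℕ) : Prop :=
  ∀ v : V, chromNum (G.induce (insert v (G.neighborSet v))) ≤ s

/-- The set of vertices at distance at most `r` from `v` in `G`. -/
def ballSet {V : Type*} (G : SimpleGraph V) (v : V) (r : ℕ) : Set V :=
  {u : V | ∃ w : G.Walk v u, w.length ≤ r}

/-- `G` is `r`-locally `s`-colourable: every ball of radius `r` induces an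
`s`-colourable subgraph. -/
def RLocallyColorable {V : Type*} (G : SimpleGraph V) (r s : ℕ) : Prop :=
  ∀ v : V, chromNum (G.induce (ballSet G v r)) ≤ s

/-- `G` contains no cycle of length exactly `n` as a (not necessarily induced) subgraph. -/
def CycleLenFree {V : Type*} (G : SimpleGraph V) (n : ℕ) : Prop :=
  ∀ (v : V) (w : G.Walk v v), w.IsCycle → w.length ≠ n

/-- `H` is `k`-degenerate: every non-empty (induced) subgraph contains a vertex of
degree at most `k` in it. -/
def Degenerate {α : Type*} (H : SimpleGraph α) (k : ℕ) : Prop :=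
  ∀ S : Set α, S.Nonempty → ∃ a ∈ S, {b | b ∈ S ∧ H.Adj a b}.ncard ≤ k

/-- `G` is co-locally `s`-colourable: for all vertices `u ≠ v`,
`χ(G[{u} ∪ N(v)]) ≤ s`. -/
def CoLocallyColorable {V : Type*} (G : SimpleGraph V) (s : ℕ) : Prop :=
  ∀ v u : V, u ≠ v → chromNum (G.induce (insert u (G.neighborSet v))) ≤ s

/-- The minimum of `χ(G[X])` over all subsets `X ⊆ V(G)` spanning exactly `p` colours
of `σ` (a rainbow cover of `σ` when `σ` uses exactly `p` colours). -/
noncomputable def minRainbowChrom {V : Type*} (G : SimpleGraph V) (σ : V → ℕ) (p : ℕ) : ℕ :=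
  sInf {c : ℕ | ∃ X : Set V, (σ '' X).ncard = p ∧ c = chromNum (G.induce X)}

/-- `f_G(p)`: the maximum, over all proper colourings `σ` of `G` using exactly `p`
colours, of the minimum chromatic number of a rainbow cover of `σ`. -/
noncomputable def fG {V : Type*} (G : SimpleGraph V) (p : ℕ) : ℕ :=
  sSup {m : ℕ | ∃ σ : V → ℕ, IsProperColoring G σ ∧ (σ '' Set.univ).ncard = p ∧
    m = minRainbowChrom G σ p}

/-- The closed neighbourhood `N[X]` of a set `X` of vertices. -/
def closedNbhd {V : Type*} (G : SimpleGraph V) (X : Set V) : Set V :=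
  X ∪ {u : V | ∃ x ∈ X, G.Adj x u}


namespace LocCol

variable {V : Type*} [DecidableEq V]

/-- `f` is proper on `S`. -/
def Prop' (G : SimpleGraph V) (S : Finset V) (f : V → ℕ) : Prop :=
  ∀ u ∈ S, ∀ v ∈ S, G.Adj u v → f u ≠ f v

def ColSet (G : SimpleGraph V) (S : Finset V) : Set ℕ :=
  {c | ∃ f : V → ℕ, Prop' G S f ∧ (S.image f).card ≤ c}

noncomputable def chi (G : SimpleGraph V) (S : Finset V) : ℕ := sInf (ColSet G S)

variable {G : SimpleGraph V}

lemma chi_le {S : Finset V} {f : V → ℕ} (hf : Prop' G S f) : chi G S ≤ (S.image f).card :=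
  Nat.sInf_le ⟨f, hf, le_rfl⟩

lemma exists_inj (S : Finset V) : ∃ f : V → ℕ, Set.InjOn f S := by
  classical
  refine ⟨fun v => if h : v ∈ S then (S.equivFin ⟨v, h⟩ : ℕ) else 0, ?_⟩
  intro u hu v hv h
  have hu' : u ∈ S := hu
  have hv' : v ∈ S := hv
  simp only [hu', hv', dif_pos] at h
  have := S.equivFin.injective (Fin.ext h)
  simpa using this

lemma chi_spec (G : SimpleGraph V) (S : Finset V) :
    ∃ f : V → ℕ, Prop' G S f ∧ (S.image f).card = chi G S := by
  have hne : (ColSet G S).Nonempty := by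
    obtain ⟨f, hf⟩ := exists_inj S
    exact ⟨_, f, fun u hu v hv h e => h.ne (hf hu hv e), le_rfl⟩
  obtain ⟨f, hf, h⟩ := Nat.sInf_mem hne
  exact ⟨f, hf, le_antisymm h (chi_le hf)⟩

lemma Prop'.mono {S T : Finset V} {f : V → ℕ} (h : Prop' G T f) (hST : S ⊆ T) : Prop' G S f :=
  fun u hu v hv => h u (hST hu) v (hST hv)

lemma chi_mono {S T : Finset V} (hST : S ⊆ T) : chi G S ≤ chi G T := by
  obtain ⟨f, hf, h⟩ := chi_spec G T
  exact (chi_le (hf.mono hST)).trans (h ▸ Finset.card_le_card (Finset.image_subset_image hST))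

lemma chi_union (S T : Finset V) : chi G (S ∪ T) ≤ chi G S + chi G T := by
  obtain ⟨f, hf, h⟩ := chi_spec G S
  obtain ⟨g, hg, h'⟩ := chi_spec G T
  have hp : Prop' G (S ∪ T) (fun v => if v ∈ S then 2 * f v else 2 * g v + 1) := by
    intro u hu v hv ha
    rw [Finset.mem_union] at hu hv
    by_cases h1 : u ∈ S <;> by_cases h2 : v ∈ S <;> simp only [h1, h2, if_true, if_false]
    · have := hf u h1 v h2 ha
      omega
    · omega
    · omega
    · have := hg u (by tauto) v (by tauto) ha
      omega
  refine (chi_le hp).trans ?_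
  rw [← h, ← h']
  have : (S ∪ T).image (fun v => if v ∈ S then 2 * f v else 2 * g v + 1) ⊆
      (S.image f).image (fun n => 2 * n) ∪ (T.image g).image (fun n => 2 * n + 1) := by
    intro x hx
    simp only [Finset.mem_image, Finset.mem_union] at hx ⊢
    obtain ⟨v, hv, rfl⟩ := hx
    by_cases h1 : v ∈ S
    · left; exact ⟨f v, ⟨v, h1, rfl⟩, by simp [h1]⟩
    · right; exact ⟨g v, ⟨v, by tauto, rfl⟩, by simp [h1]⟩
  refine (Finset.card_le_card this).trans ((Finset.card_union_le _ _).trans ?_)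
  exact Nat.add_le_add Finset.card_image_le Finset.card_image_le

lemma chi_indep {S : Finset V} (h : ∀ u ∈ S, ∀ v ∈ S, ¬ G.Adj u v) : chi G S ≤ 1 := by
  refine (chi_le (f := fun _ => 0) (fun u hu v hv ha => (h u hu v hv ha).elim)).trans ?_
  refine Finset.card_le_one.2 ?_
  intro a ha b hb
  simp only [Finset.mem_image] at ha hb
  obtain ⟨_, _, rfl⟩ := ha
  obtain ⟨_, _, rfl⟩ := hb
  rfl

lemma chi_clique {S : Finset V} (h : ∀ u ∈ S, ∀ v ∈ S, u ≠ v → G.Adj u v) :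
    S.card ≤ chi G S := by
  obtain ⟨f, hf, h'⟩ := chi_spec G S
  rw [← h', Finset.card_image_of_injOn]
  intro u hu v hv e
  by_contra hne
  exact hf u hu v hv (h u hu v hv hne) e

lemma card_images {A B : Finset V} {f : V → ℕ} (h : ∀ x ∈ A, ∀ y ∈ B, f x ≠ f y) :
    (A.image f).card + (B.image f).card = ((A ∪ B).image f).card := by
  rw [Finset.image_union, Finset.card_union_of_disjoint]
  rw [Finset.disjoint_left]
  intro c hc hc'
  simp only [Finset.mem_image] at hc hc'
  obtain ⟨x, hx, rfl⟩ := hc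
  obtain ⟨y, hy, e⟩ := hc'
  exact h x hx y hy e.symm

lemma chi_join {A B : Finset V} (h : ∀ x ∈ A, ∀ y ∈ B, G.Adj x y) :
    chi G (A ∪ B) = chi G A + chi G B := by
  refine le_antisymm (chi_union A B) ?_
  obtain ⟨f, hf, h'⟩ := chi_spec G (A ∪ B)
  rw [← h', ← card_images (f := f) (A := A) (B := B)
    (fun x hx y hy => hf x (by simp [hx]) y (by simp [hy]) (h x hx y hy))]
  exact Nat.add_le_add (chi_le (hf.mono Finset.subset_union_left))
    (chi_le (hf.mono Finset.subset_union_right))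

/-- singletons of the colouring -/
def sing (S : Finset V) (f : V → ℕ) : Finset V :=
  S.filter (fun v => ∀ u ∈ S, f u = f v → u = v)

lemma mem_sing {S : Finset V} {f : V → ℕ} {v : V} :
    v ∈ sing S f ↔ v ∈ S ∧ ∀ u ∈ S, f u = f v → u = v := by
  simp [sing]

def Good (G : SimpleGraph V) (S : Finset V) (f : V → ℕ) : Prop :=
  Prop' G S f ∧ (S.image f).card ≤ chi G S

def Opt (G : SimpleGraph V) (S : Finset V) (f : V → ℕ) : Prop :=
  Good G S f ∧ ∀ g, Good G S g → (sing S f).card ≤ (sing S g).card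

lemma exists_opt (G : SimpleGraph V) (S : Finset V) : ∃ f, Opt G S f := by
  classical
  have hne : ∃ t, ∃ f, Good G S f ∧ (sing S f).card = t := by
    obtain ⟨f, hf, h⟩ := chi_spec G S
    exact ⟨_, f, ⟨hf, h.le⟩, rfl⟩
  obtain ⟨f, hf, h⟩ := Nat.find_spec hne
  refine ⟨f, hf, fun g hg => ?_⟩
  rw [h]
  exact Nat.find_min' hne ⟨g, hg, rfl⟩

lemma swap {S : Finset V} {f : V → ℕ} (hf : Opt G S f) {d z : V} (hd : d ∈ sing S f)
    (hz : z ∈ S) (hzd : z ≠ d) (hna : ¬ G.Adj d z) :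
    Opt G S (Function.update f z (f d)) ∧
    (∀ w ∈ sing S f, w ≠ d → w ∈ sing S (Function.update f z (f d))) ∧
    (∃ y ∈ S, y ≠ z ∧ f y = f z) ∧
    (∀ y ∈ S, y ≠ z → f y = f z → y ∈ sing S (Function.update f z (f d))) := by
  set g := Function.update f z (f d) with hg
  have gz : g z = f d := by simp [hg]
  have gn : ∀ v, v ≠ z → g v = f v := fun v hv => by simp [hg, hv]
  have hdS := (mem_sing.1 hd).1
  have hdu := (mem_sing.1 hd).2
  have gp : Prop' G S g := by
    intro u hu v hv ha e
    by_cases h1 : u = z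
    · by_cases h2 : v = z
      · subst h1; subst h2; exact ha.ne rfl
      · rw [h1, gz, gn v h2] at e
        have := hdu v hv e.symm
        subst this; subst h1
        exact hna ha.symm
    · by_cases h2 : v = z
      · rw [h2, gz, gn u h1] at e
        have := hdu u hu e
        subst this; subst h2
        exact hna ha
      · rw [gn u h1, gn v h2] at e
        exact hf.1.1 u hu v hv ha e
  have gsub : S.image g ⊆ S.image f := by
    intro c hc
    simp only [Finset.mem_image] at hc ⊢
    obtain ⟨v, hv, rfl⟩ := hc
    by_cases h : v = z
    · exact ⟨d, hdS, by rw [h, gz]⟩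
    · exact ⟨v, hv, (gn v h).symm⟩
  have gG : Good G S g := ⟨gp, (Finset.card_le_card gsub).trans hf.1.2⟩
  have hex : ∃ y ∈ S, y ≠ z ∧ f y = f z := by
    by_contra hcon
    push Not at hcon
    have : S.image g ⊂ S.image f := by
      refine (Finset.ssubset_iff_of_subset gsub).2 ⟨f z, Finset.mem_image_of_mem _ hz, ?_⟩
      simp only [Finset.mem_image, not_exists, not_and]
      intro v hv e
      by_cases h : v = z
      · rw [h, gz] at e
        exact hzd (hdu z hz e.symm)
      · rw [gn v h] at e
        exact hcon v hv h e
    have h1 := Finset.card_lt_card this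
    have h2 := chi_le gp
    have h3 := hf.1.2
    omega
  have hsd : ∀ v ∈ sing S g, v ≠ d ∧ v ≠ z := by
    intro v hv
    have hv' := (mem_sing.1 hv).2
    constructor
    · rintro rfl
      exact hzd (hv' z hz (by rw [gz, gn _ hzd.symm]))
    · rintro rfl
      exact hzd (hv' d hdS (by rw [gz, gn _ hzd.symm])).symm
  have hsf : ∀ v ∈ sing S g, v ∈ sing S f ∨ (f v = f z ∧ ∀ y ∈ S, y ≠ z → f y = f z → y = v) := by
    intro v hv
    obtain ⟨hvS, hv'⟩ := mem_sing.1 hv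
    obtain ⟨h1, h2⟩ := hsd v hv
    by_cases hc : f v = f z
    · right
      refine ⟨hc, fun y hy hyz e => hv' y hy ?_⟩
      rw [gn y hyz, gn v h2, e, hc]
    · left
      refine mem_sing.2 ⟨hvS, fun u hu e => ?_⟩
      have : u ≠ z := by rintro rfl; exact hc e.symm
      exact hv' u hu (by rw [gn u this, gn v h2, e])
  obtain ⟨y, hy, hyz, hfy⟩ := hex
  have huniq : ∀ y' ∈ S, y' ≠ z → f y' = f z → y' = y := by
    by_contra hcon
    push Not at hcon
    obtain ⟨y', hy', hyz', hfy', hne⟩ := hcon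
    have hsub : sing S g ⊆ (sing S f).erase d := by
      intro v hv
      refine Finset.mem_erase.2 ⟨(hsd v hv).1, ?_⟩
      rcases hsf v hv with h | ⟨_, h⟩
      · exact h
      · exact (hne ((h y' hy' hyz' hfy').trans (h y hy hyz hfy).symm)).elim
    have h1 := Finset.card_le_card hsub
    rw [Finset.card_erase_of_mem hd] at h1
    have h2 := hf.2 g gG
    have h3 : 0 < (sing S f).card := Finset.card_pos.2 ⟨d, hd⟩
    omega
  have hcard : (sing S g).card ≤ (sing S f).card := by
    have hsub : sing S g ⊆ insert y ((sing S f).erase d) := by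
      intro v hv
      rcases hsf v hv with h | ⟨_, h⟩
      · exact Finset.mem_insert_of_mem (Finset.mem_erase.2 ⟨(hsd v hv).1, h⟩)
      · rw [h y hy hyz hfy]; exact Finset.mem_insert_self _ _
    have h1 := (Finset.card_le_card hsub).trans (Finset.card_insert_le _ _)
    rw [Finset.card_erase_of_mem hd] at h1
    have h3 : 0 < (sing S f).card := Finset.card_pos.2 ⟨d, hd⟩
    omega
  refine ⟨⟨gG, fun h hh => hcard.trans (hf.2 h hh)⟩, ?_, ⟨y, hy, hyz, hfy⟩, ?_⟩
  · intro w hw hwd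
    obtain ⟨hwS, hw'⟩ := mem_sing.1 hw
    have hwz : w ≠ z := by
      rintro rfl
      exact hyz (hw' y hy hfy)
    refine mem_sing.2 ⟨hwS, fun u hu e => ?_⟩
    rw [gn w hwz] at e
    by_cases h : u = z
    · rw [h, gz] at e
      exact (hwd (hw' d hdS e).symm).elim
    · rw [gn u h] at e
      exact hw' u hu e
  · intro y' hy' hyz' hfy'
    refine mem_sing.2 ⟨hy', fun u hu e => ?_⟩
    rw [gn y' hyz'] at e
    by_cases h : u = z
    · rw [h, gz] at e
      have h5 := hdu y' hy' e.symm
      have h6 := hdu z hz (by rw [← hfy', ← e])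
      exact (hzd h6).elim
    · rw [gn u h] at e
      rw [huniq u hu h (e.trans hfy'), huniq y' hy' hyz' hfy']

def Reach (S : Finset V) (c f : V → ℕ) (a : V) : ℕ → V → Prop
  | 0, v => v = a
  | m + 1, v => ∃ y z, Reach S c f a m y ∧ z ∈ S ∧ v ∈ S ∧ f y = f z ∧ c z = c v

lemma reach_mem {S : Finset V} {c f : V → ℕ} {a : V} (ha : a ∈ S) :
    ∀ m v, Reach S c f a m v → v ∈ S
  | 0, v, h => by
    have h' : v = a := h
    rw [h']; exact ha
  | m + 1, v, ⟨_, _, _, _, h, _⟩ => h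

lemma shift {S : Finset V} {c : V → ℕ} (hc : Prop' G S c) {a : V} (haS : a ∈ S)
    (ha : ∀ v ∈ S, c v = c a → v = a) (w : V) :
    ∀ m, ∀ f d, Opt G S f → d ∈ sing S f → w ∈ sing S f → w ≠ d → Reach S c f a m d →
      ∃ g, Opt G S g ∧ a ∈ sing S g ∧ w ∈ sing S g := by
  intro m
  induction m using Nat.strong_induction_on with
  | _ m ih =>
  intro f d hf hd hw hwd hr
  by_cases hlt : ∃ j < m, Reach S c f a j d
  · obtain ⟨j, hj, hrj⟩ := hlt
    exact ih j hj f d hf hd hw hwd hrj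
  push Not at hlt
  match m, hr with
  | 0, hr =>
    have h' : d = a := hr
    subst h'
    exact ⟨f, hf, hd, hw⟩
  | m + 1, ⟨y, z, hry, hzS, hdS, hyz, hzd⟩ =>
    have hdu := (mem_sing.1 hd).2
    have hyS := reach_mem haS m y hry
    have hzned : z ≠ d := by
      rintro rfl
      have := hdu y hyS hyz
      subst this
      exact hlt m (by omega) hry
    have hnr : ∀ j ≤ m, ¬ Reach S c f a j z := by
      intro j hj hr
      match j, hr with
      | 0, hr =>
        have h' : z = a := hr
        subst h'
        exact hzned (ha d hdS hzd.symm).symm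
      | j + 1, ⟨y', z', h1, h2, h3, h4, h5⟩ =>
        exact hlt (j + 1) (by omega) ⟨y', z', h1, h2, hdS, h4, h5.trans hzd⟩
    have hyne : y ≠ z := by
      rintro rfl
      exact hnr m le_rfl hry
    have hna : ¬ G.Adj d z := fun h => hc d hdS z hzS h hzd.symm
    obtain ⟨h1, h2, -, h4⟩ := swap hf hd hzS hzned hna
    have hwy : w ≠ y := by
      rintro rfl
      exact hyne ((mem_sing.1 hw).2 z hzS hyz.symm).symm
    refine ih m (by omega) _ y h1 (h4 y hyS hyne hyz) (h2 w hw hwd) hwy ?_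
    have key : ∀ j, j ≤ m → ∀ v, Reach S c f a j v →
        Reach S c (Function.update f z (f d)) a j v := by
      intro j
      induction j with
      | zero => intro _ v h; exact h
      | succ j ihj =>
        rintro hj v ⟨y', z', e1, e2, e3, e4, e5⟩
        refine ⟨y', z', ihj (by omega) y' e1, e2, e3, ?_, e5⟩
        have n1 : y' ≠ z := by
          rintro rfl
          exact hnr j (by omega) e1
        have n2 : z' ≠ z := by
          rintro rfl
          exact hlt (j + 1) (by omega) ⟨y', z', e1, e2, hdS, e4, hzd⟩
        simp [n1, n2, e4]
    exact key m le_rfl y hry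

lemma step {S : Finset V} (hcrit : ∀ a ∈ S, chi G (S.erase a) + 1 ≤ chi G S) {f : V → ℕ}
    (hf : Opt G S f) {u w a : V} (hu : u ∈ sing S f) (hw : w ∈ sing S f) (huw : w ≠ u)
    (ha : a ∈ S) (hau : a ≠ u) (hna : ¬ G.Adj u a) :
    ∃ g, Opt G S g ∧ a ∈ sing S g ∧ w ∈ sing S g := by
  classical
  obtain ⟨c₀, hc₀, hcard⟩ := chi_spec G (S.erase a)
  have hk := hcrit a ha
  obtain ⟨N, hN⟩ : ∃ N, ∀ v ∈ S.erase a, c₀ v ≠ N := by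
    obtain ⟨N, hN⟩ := Infinite.exists_notMem_finset ((S.erase a).image c₀)
    exact ⟨N, fun v hv e => hN (e ▸ Finset.mem_image_of_mem _ hv)⟩
  set c := Function.update c₀ a N with hcdef
  have ca : c a = N := by simp [hcdef]
  have cn : ∀ v, v ≠ a → c v = c₀ v := fun v hv => by simp [hcdef, hv]
  have hasing : ∀ v ∈ S, c v = c a → v = a := by
    intro v hv e
    by_contra hne
    rw [ca, cn v hne] at e
    exact hN v (Finset.mem_erase.2 ⟨hne, hv⟩) e
  have hc : Prop' G S c := by
    intro x hx y hy hxy e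
    by_cases h1 : x = a
    · subst h1
      exact hxy.ne (hasing y hy e.symm).symm
    · by_cases h2 : y = a
      · subst h2
        exact hxy.ne (hasing x hx e)
      · rw [cn x h1, cn y h2] at e
        exact hc₀ x (Finset.mem_erase.2 ⟨h1, hx⟩) y (Finset.mem_erase.2 ⟨h2, hy⟩) hxy e
  by_cases hr : ∃ m, Reach S c f a m u
  · obtain ⟨m, hm⟩ := hr
    exact shift hc ha hasing w m f u hf hu hw huw hm
  exfalso
  set W := S.filter (fun v => ∃ m, Reach S c f a m v) with hW
  have hWS : W ⊆ S := Finset.filter_subset _ _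
  have haW : a ∈ W := Finset.mem_filter.2 ⟨ha, 0, rfl⟩
  obtain ⟨huS, hu'⟩ := mem_sing.1 hu
  have huW : u ∉ W := fun h => hr (Finset.mem_filter.1 h).2
  have clf : ∀ x ∈ W, ∀ y ∈ S \ W, f x ≠ f y := by
    intro x hx y hy e
    obtain ⟨hyS, hyW⟩ := Finset.mem_sdiff.1 hy
    obtain ⟨hxS, m, hm⟩ := Finset.mem_filter.1 hx
    exact hyW (Finset.mem_filter.2 ⟨hyS, m + 1, x, y, hm, hyS, hyS, e, rfl⟩)
  have clc : ∀ x ∈ W, ∀ y ∈ S \ W, c x ≠ c y := by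
    intro x hx y hy e
    obtain ⟨hyS, hyW⟩ := Finset.mem_sdiff.1 hy
    obtain ⟨hxS, m, hm⟩ := Finset.mem_filter.1 hx
    exact hyW (Finset.mem_filter.2 ⟨hyS, m + 1, x, x, hm, hxS, hyS, rfl, e⟩)
  have hun : W ∪ (S \ W) = S := Finset.union_sdiff_of_subset hWS
  have e1 := card_images clf
  rw [hun] at e1
  have e2 := card_images (A := W.erase a) (B := S \ W) (f := c₀) (by
    intro x hx y hy
    have hya : y ≠ a := by
      rintro rfl
      exact (Finset.mem_sdiff.1 hy).2 haW
    rw [← cn x (Finset.ne_of_mem_erase hx), ← cn y hya]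
    exact clc x (Finset.mem_of_mem_erase hx) y hy)
  have hun2 : W.erase a ∪ (S \ W) = S.erase a := by
    ext v
    simp only [Finset.mem_union, Finset.mem_erase, Finset.mem_sdiff]
    constructor
    · rintro (⟨h1, h2⟩ | ⟨h1, h2⟩)
      · exact ⟨h1, hWS h2⟩
      · exact ⟨fun h => h2 (h ▸ haW), h1⟩
    · rintro ⟨h1, h2⟩
      by_cases h : v ∈ W
      · exact Or.inl ⟨h1, h⟩
      · exact Or.inr ⟨h2, h⟩
  rw [hun2, hcard] at e2
  have sub2 : S \ W ⊆ S.erase a := hun2 ▸ Finset.subset_union_right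
  have sub1 : W.erase a ⊆ S.erase a := hun2 ▸ Finset.subset_union_left
  have b1 : chi G S ≤ chi G W + chi G (S \ W) := by
    have := chi_union (G := G) W (S \ W)
    rwa [hun] at this
  have b2 : chi G W ≤ (W.image f).card := chi_le (hf.1.1.mono hWS)
  have b3 : chi G (S \ W) ≤ ((S \ W).image c₀).card := chi_le (hc₀.mono sub2)
  have b4 : chi G (W.erase a) ≤ ((W.erase a).image c₀).card := chi_le (hc₀.mono sub1)
  have b5 : chi G ((S \ W).erase u) ≤ (((S \ W).erase u).image f).card :=
    chi_le (hf.1.1.mono ((Finset.erase_subset _ _).trans Finset.sdiff_subset))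
  have huSW : u ∈ S \ W := Finset.mem_sdiff.2 ⟨huS, huW⟩
  have b6 : (((S \ W).erase u).image f).card + 1 ≤ ((S \ W).image f).card := by
    have := card_images (A := (S \ W).erase u) (B := {u}) (f := f) (by
      intro x hx y hy e
      rw [Finset.mem_singleton] at hy
      subst hy
      exact Finset.ne_of_mem_erase hx
        (hu' x (Finset.mem_sdiff.1 (Finset.mem_of_mem_erase hx)).1 e))
    have h2 : (S \ W).erase u ∪ {u} = S \ W := by
      rw [Finset.union_comm, ← Finset.insert_eq, Finset.insert_erase huSW]
    rw [h2] at this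
    simp at this
    omega
  have b7 : chi G {a, u} ≤ 1 := by
    apply chi_indep
    intro x hx y hy hxy
    simp only [Finset.mem_insert, Finset.mem_singleton] at hx hy
    rcases hx with rfl | rfl <;> rcases hy with rfl | rfl
    · exact hxy.ne rfl
    · exact hna hxy.symm
    · exact hna hxy
    · exact hxy.ne rfl
  have b8 : chi G S ≤ chi G ((S \ W).erase u) + chi G (W.erase a) + chi G {a, u} := by
    have h1 := chi_union (G := G) ((S \ W).erase u ∪ W.erase a) {a, u}
    have h2 := chi_union (G := G) ((S \ W).erase u) (W.erase a)
    have h3 : S ⊆ (S \ W).erase u ∪ W.erase a ∪ {a, u} := by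
      intro v hv
      simp only [Finset.mem_union, Finset.mem_erase, Finset.mem_sdiff, Finset.mem_insert,
        Finset.mem_singleton]
      tauto
    have := chi_mono (G := G) h3
    omega
  have := hf.1.2
  omega

lemma gallai {S : Finset V} (hcrit : ∀ a ∈ S, chi G (S.erase a) + 1 ≤ chi G S) :
    2 * chi G S ≤ S.card + 1 ∨
    ∃ A ⊆ S, A.Nonempty ∧ (S \ A).Nonempty ∧ ∀ x ∈ A, ∀ y ∈ S \ A, G.Adj x y := by
  classical
  obtain ⟨f, hf⟩ := exists_opt G S
  by_cases h1 : (sing S f).card ≤ 1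
  · left
    have hsS : sing S f ⊆ S := Finset.filter_subset _ _
    have e1 : chi G S ≤ ((S \ sing S f).image f).card + (sing S f).card := by
      refine (chi_le hf.1.1).trans ?_
      conv_lhs => rw [← Finset.sdiff_union_of_subset hsS]
      rw [Finset.image_union]
      exact (Finset.card_union_le _ _).trans (Nat.add_le_add le_rfl Finset.card_image_le)
    have e2 : 2 * ((S \ sing S f).image f).card ≤ (S \ sing S f).card := by
      rw [Finset.card_eq_sum_card_image f (S \ sing S f), mul_comm, ← smul_eq_mul]
      refine Finset.card_nsmul_le_sum _ _ _ ?_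
      intro b hb
      obtain ⟨x, hx, rfl⟩ := Finset.mem_image.1 hb
      obtain ⟨hxS, hxs⟩ := Finset.mem_sdiff.1 hx
      have : ∃ y ∈ S, f y = f x ∧ y ≠ x := by
        by_contra hcon
        push Not at hcon
        exact hxs (mem_sing.2 ⟨hxS, hcon⟩)
      obtain ⟨y, hy, hyx, hne⟩ := this
      have hys : y ∉ sing S f := fun h => hne ((mem_sing.1 h).2 x hxS hyx.symm).symm
      have h2 : 1 < ((S \ sing S f).filter (fun v => f v = f x)).card :=
        Finset.one_lt_card.2 ⟨x, Finset.mem_filter.2 ⟨hx, rfl⟩, y,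
          Finset.mem_filter.2 ⟨Finset.mem_sdiff.2 ⟨hy, hys⟩, hyx⟩, hne.symm⟩
      exact h2
    have e3 := Finset.card_sdiff_add_card_eq_card hsS
    omega
  · right
    push Not at h1
    obtain ⟨u, hu, w, hw, huw⟩ := Finset.one_lt_card.1 h1
    refine ⟨S.filter (fun x => x ≠ w ∧ ∃ g, Opt G S g ∧ x ∈ sing S g ∧ w ∈ sing S g),
      Finset.filter_subset _ _,
      ⟨u, Finset.mem_filter.2 ⟨(mem_sing.1 hu).1, huw, f, hf, hu, hw⟩⟩,
      ⟨w, Finset.mem_sdiff.2 ⟨(mem_sing.1 hw).1, fun h => (Finset.mem_filter.1 h).2.1 rfl⟩⟩, ?_⟩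
    intro x hx y hy
    have hx0 := hx
    obtain ⟨hxS, hxw, g, hg, hxg, hwg⟩ := Finset.mem_filter.1 hx
    obtain ⟨hyS, hyn⟩ := Finset.mem_sdiff.1 hy
    by_contra hna
    have hyx : y ≠ x := by
      rintro rfl
      exact hyn hx0
    have hyw : y ≠ w := by
      rintro rfl
      obtain ⟨z, hz, hzy, e⟩ := (swap hg hxg hyS hyx hna).2.2.1
      exact hzy ((mem_sing.1 hwg).2 z hz e)
    exact hyn (Finset.mem_filter.2 ⟨hyS, hyw, step hcrit hg hxg hwg hxw.symm hyS hyx hna⟩)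

open Classical in
/-- neighbourhood inside `S` -/
noncomputable def nb (G : SimpleGraph V) (S : Finset V) (v : V) : Finset V :=
  S.filter (fun u => G.Adj v u)

lemma mem_nb {S : Finset V} {v u : V} : u ∈ nb G S v ↔ u ∈ S ∧ G.Adj v u := by
  simp [nb]

lemma nb_mono {S T : Finset V} (h : S ⊆ T) (v : V) : nb G S v ⊆ nb G T v := by
  intro u hu
  rw [mem_nb] at hu ⊢
  exact ⟨h hu.1, hu.2⟩

def Hyp (G : SimpleGraph V) (j : ℕ) (S : Finset V) : Prop :=
  ∀ v ∈ S, chi G (nb G S v) + j ≤ chi G S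

lemma hyp_join {j : ℕ} {A B : Finset V} (h : ∀ x ∈ A, ∀ y ∈ B, G.Adj x y)
    (hy : Hyp G j (A ∪ B)) : Hyp G j A := by
  intro v hv
  have h1 := hy v (Finset.mem_union_left _ hv)
  have h2 : nb G (A ∪ B) v = nb G A v ∪ B := by
    ext u
    simp only [mem_nb, Finset.mem_union]
    constructor
    · tauto
    · rintro (h' | h')
      · tauto
      · exact ⟨Or.inr h', h v hv u h'⟩
  rw [h2, chi_join h, chi_join (fun x hx y hy => h x (mem_nb.1 hx).1 y hy)] at h1
  omega

lemma reduce (j a b : ℕ)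
    (base : ∀ S : Finset V, Hyp G j S → 2 * chi G S ≤ S.card + 1 → a * chi G S ≤ b * S.card) :
    ∀ n, ∀ S : Finset V, S.card = n → Hyp G j S → a * chi G S ≤ b * S.card := by
  intro n
  induction n using Nat.strong_induction_on with
  | _ n ih =>
  intro S hn hS
  by_cases hcrit : ∀ x ∈ S, chi G (S.erase x) + 1 ≤ chi G S
  · rcases gallai hcrit with h | ⟨A, hA, hne, hne', hadj⟩
    · exact base S hS h
    · have hun : A ∪ (S \ A) = S := Finset.union_sdiff_of_subset hA
      have hadj' : ∀ x ∈ S \ A, ∀ y ∈ A, G.Adj x y := fun x hx y hy => (hadj y hy x hx).symm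
      have e := chi_join hadj
      rw [hun] at e
      have hc := Finset.card_sdiff_add_card_eq_card hA
      have p1 := hne.card_pos
      have p2 := hne'.card_pos
      have i1 := ih A.card (by omega) A rfl (hyp_join hadj (by rw [hun]; exact hS))
      have i2 := ih (S \ A).card (by omega) (S \ A) rfl
        (hyp_join hadj' (by rw [Finset.union_comm, hun]; exact hS))
      rw [e, ← hc, mul_add, mul_add]
      omega
  · push Not at hcrit
    obtain ⟨x, hx, hlt⟩ := hcrit
    have hm := chi_mono (G := G) (Finset.erase_subset x S)
    have he : chi G (S.erase x) = chi G S := by omega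
    have hp := Finset.card_pos.2 ⟨x, hx⟩
    have hc := Finset.card_erase_of_mem hx
    have := ih (S.erase x).card (by omega) (S.erase x) rfl (by
      intro v hv
      have := hS v (Finset.mem_of_mem_erase hv)
      have := chi_mono (G := G) (nb_mono (G := G) (Finset.erase_subset x S) v)
      omega)
    rw [he] at this
    exact this.trans (Nat.mul_le_mul_left _ (by omega))

lemma chi_empty : chi G (∅ : Finset V) = 0 := by
  have := chi_le (G := G) (S := ∅) (f := fun _ => 0) (by intro u hu; simp at hu)
  simpa using this

lemma chi_pos {S : Finset V} (h : S.Nonempty) : 1 ≤ chi G S := by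
  obtain ⟨f, _, h'⟩ := chi_spec G S
  rw [← h']
  exact (h.image f).card_pos

lemma bound2 (S : Finset V) (hS : Hyp G 2 S) : 5 * chi G S ≤ 3 * S.card := by
  refine reduce 2 5 3 ?_ S.card S rfl hS
  intro S hS h
  rcases S.eq_empty_or_nonempty with rfl | ⟨v, hv⟩
  · simp [chi_empty]
  have : 3 ≤ chi G S := by
    by_contra hlt
    have : chi G S ≤ 1 := by
      apply chi_indep
      intro x hx y hy hxy
      have h1 := hS x hx
      have h2 := chi_pos (G := G) ⟨y, mem_nb.2 ⟨hy, hxy⟩⟩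
      omega
    have := hS v hv
    omega
  omega

lemma bound3 (S : Finset V) (hS : Hyp G 3 S) : 11 * chi G S ≤ 6 * S.card := by
  classical
  refine reduce 3 11 6 ?_ S.card S rfl hS
  intro S hS h
  by_contra hcon
  have hk : chi G S ≤ 5 := by omega
  have hn : S.card + 1 = 2 * chi G S := by omega
  have hSne : S.Nonempty := by
    rw [← Finset.card_pos]; omega
  obtain ⟨u, hu⟩ := hSne
  have hu3 := hS u hu
  have alpha : ∀ I ⊆ S, (∀ x ∈ I, ∀ y ∈ I, ¬ G.Adj x y) → I.card ≤ 2 := by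
    intro I hI hind
    by_contra hc
    have h1 := chi_indep hind
    have h2 := chi_union (G := G) I (S \ I)
    rw [Finset.union_sdiff_of_subset hI] at h2
    have h3 := Finset.card_sdiff_add_card_eq_card hI
    have h4 := bound2 (G := G) (S \ I) (by
      intro v hv
      have a1 := hS v (Finset.mem_sdiff.1 hv).1
      have a2 := chi_mono (G := G) (nb_mono (G := G) (Finset.sdiff_subset : S \ I ⊆ S) v)
      omega)
    omega
  have hdeg : (nb G S u).card ≤ 2 * chi G (nb G S u) := by
    obtain ⟨f, hf, h'⟩ := chi_spec G (nb G S u)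
    rw [← h']
    refine Finset.card_le_mul_card_image _ 2 ?_
    intro b _
    refine alpha _ ?_ ?_
    · intro x hx
      exact (mem_nb.1 (Finset.mem_filter.1 hx).1).1
    · intro x hx y hy hxy
      obtain ⟨hx1, hx2⟩ := Finset.mem_filter.1 hx
      obtain ⟨hy1, hy2⟩ := Finset.mem_filter.1 hy
      exact hf x hx1 y hy1 hxy (hx2.trans hy2.symm)
  set K := (S \ nb G S u).erase u with hK
  have hKS : ∀ x ∈ K, x ∈ S ∧ ¬ G.Adj u x ∧ x ≠ u := by
    intro x hx
    rw [hK, Finset.mem_erase, Finset.mem_sdiff, mem_nb] at hx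
    tauto
  have hKc : 4 ≤ K.card := by
    have hsub : nb G S u ⊆ S := fun x hx => (mem_nb.1 hx).1
    have h3 := Finset.card_sdiff_add_card_eq_card hsub
    have h4 : u ∈ S \ nb G S u :=
      Finset.mem_sdiff.2 ⟨hu, fun h => (mem_nb.1 h).2.ne rfl⟩
    have h5 := Finset.card_erase_of_mem h4
    rw [← hK] at h5
    omega
  have hclique : ∀ x ∈ K, ∀ y ∈ K, x ≠ y → G.Adj x y := by
    intro x hx y hy hxy
    by_contra hna
    obtain ⟨x1, x2, x3⟩ := hKS x hx
    obtain ⟨y1, y2, y3⟩ := hKS y hy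
    have := alpha {u, x, y} (by
      intro z hz
      simp only [Finset.mem_insert, Finset.mem_singleton] at hz
      rcases hz with rfl | rfl | rfl <;> assumption) (by
      intro p hp q hq hpq
      have hpq' := hpq.symm
      simp only [Finset.mem_insert, Finset.mem_singleton] at hp hq
      rcases hp with rfl | rfl | rfl <;> rcases hq with rfl | rfl | rfl <;>
        first
        | exact hpq.ne rfl
        | contradiction)
    rw [Finset.card_eq_three.2 ⟨u, x, y, x3.symm, y3.symm, hxy, rfl⟩] at this
    omega
  obtain ⟨w, hw⟩ : K.Nonempty := by
    rw [← Finset.card_pos]; omega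
  have c1 := chi_clique (G := G) (S := K.erase w) (fun x hx y hy => hclique x
    (Finset.mem_of_mem_erase hx) y (Finset.mem_of_mem_erase hy))
  have c2 : K.erase w ⊆ nb G S w := by
    intro x hx
    have hxK := Finset.mem_of_mem_erase hx
    exact mem_nb.2 ⟨(hKS x hxK).1, hclique w hw x hxK (Finset.ne_of_mem_erase hx).symm⟩
  have c3 := chi_mono (G := G) c2
  have c4 := hS w (hKS w hw).1
  have c5 := Finset.card_erase_of_mem hw
  omega

lemma chi_le_chromNum (S : Finset V) (T : Set V) (hT : ∀ x ∈ S, x ∈ T) [Finite T] :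
    chi G S ≤ chromNum (G.induce T) := by
  classical
  have hne : {n : ℕ | (G.induce T).Colorable n}.Nonempty := by
    obtain ⟨n, ⟨e⟩⟩ := Finite.exists_equiv_fin T
    exact ⟨n, ⟨Coloring.mk e (fun {v w} h he => h.ne (e.injective he))⟩⟩
  have hmem : (G.induce T).Colorable (chromNum (G.induce T)) := Nat.sInf_mem hne
  obtain ⟨C⟩ := hmem
  have hp : Prop' G S (fun v => if h : v ∈ T then (C ⟨v, h⟩ : ℕ) else 0) := by
    intro u hu v hv ha e
    simp only [hT u hu, hT v hv, dif_pos] at e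
    exact C.valid (v := ⟨u, hT u hu⟩) (w := ⟨v, hT v hv⟩) ha (Fin.ext e)
  refine (chi_le hp).trans ?_
  have : S.image (fun v => if h : v ∈ T then (C ⟨v, h⟩ : ℕ) else 0) ⊆
      Finset.range (chromNum (G.induce T)) := by
    intro x hx
    obtain ⟨v, hv, rfl⟩ := Finset.mem_image.1 hx
    simp [hT v hv]
  simpa using Finset.card_le_card this

lemma chromNum_le_chi [Fintype V] : chromNum G ≤ chi G Finset.univ := by
  classical
  obtain ⟨f, hf, h⟩ := chi_spec G Finset.univ
  refine Nat.sInf_le ?_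
  have C : G.Coloring (Finset.univ.image f : Finset ℕ) :=
    Coloring.mk (fun v => ⟨f v, Finset.mem_image_of_mem _ (Finset.mem_univ v)⟩) (by
      intro v w hvw e
      exact hf v (Finset.mem_univ _) w (Finset.mem_univ _) hvw (congrArg Subtype.val e))
  have := C.colorable
  simpa [h] using this

end LocCol

/-- For every integer `s ≥ 1`, every finite locally `s`-colourable graph
`G` on `n` vertices satisfies `χ(G) ≤ max {s+1, ⌊6n/11⌋}`. -/
theorem chromNum_le_max_locallyColourable' {V : Type*} [Fintype V]
    (s : ℕ) (hs : 1 ≤ s) (G : SimpleGraph V) (hloc : LocallyColorable G s) :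
    chromNum G ≤ max (s + 1) (6 * Fintype.card V / 11) := by
  classical
  by_cases hsmall : LocCol.chi G Finset.univ ≤ s + 1
  · exact (LocCol.chromNum_le_chi.trans hsmall).trans (le_max_left _ _)
  refine le_trans ?_ (le_max_right _ _)
  have h := LocCol.bound3 (G := G) Finset.univ (by
    intro v _
    have h1 := LocCol.chi_le_chromNum (G := G) ({v} ∪ LocCol.nb G Finset.univ v)
      (insert v (G.neighborSet v)) (by
        intro x hx
        simpa [LocCol.mem_nb] using hx)
    have h2 := LocCol.chi_join (G := G) (A := {v}) (B := LocCol.nb G Finset.univ v) (by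
      intro x hx y hy
      rw [Finset.mem_singleton] at hx
      subst hx
      exact (LocCol.mem_nb.1 hy).2)
    have h3 := LocCol.chi_pos (G := G) (Finset.singleton_nonempty v)
    have h4 := hloc v
    omega)
  rw [Finset.card_univ] at h
  have := LocCol.chromNum_le_chi (G := G)
  omega
end

section
/- For every integer s ≥ 3, every finite co-locally (s−1)-colourable simple graph G with at least one vertex that is not isomorphic to the complete graph K_s and whose chromatic number χ satisfies χ < (5s+2)/3 has chromatic discrepancy φ(G) ≥ χ − s + 1. -/
open SimpleGraph

open scoped Classical in
/-- Chromatic number of the subgraph induced on a finset. -/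
noncomputable def cn {V : Type*} (G : SimpleGraph V) (S : Finset V) : ℕ :=
  chromNum (G.induce (S : Set V))

/-- `f` is a proper colouring on `S`. -/
def PropOn {V : Type*} (G : SimpleGraph V) (f : V → ℕ) (S : Finset V) : Prop :=
  ∀ u ∈ S, ∀ v ∈ S, G.Adj u v → f u ≠ f v

/-- `A` and `B` are completely joined. -/
def JoinS {V : Type*} (G : SimpleGraph V) (A B : Finset V) : Prop :=
  ∀ a ∈ A, ∀ b ∈ B, G.Adj a b

section Helpers

open scoped Classical

variable {V : Type*} (G : SimpleGraph V)

theorem cn_le_image {f : V → ℕ} {S : Finset V} (h : PropOn G f S) :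
    cn G S ≤ (S.image f).card := by
  unfold cn chromNum
  apply Nat.sInf_le
  have C : (G.induce (S : Set V)).Coloring (S.image f) :=
    Coloring.mk (fun v => ⟨f v.1, Finset.mem_image_of_mem f v.2⟩) (by
      intro u v huv heq
      exact h u.1 u.2 v.1 v.2 huv (congrArg Subtype.val heq))
  have := C.colorable
  simpa using this

theorem cn_spec (S : Finset V) : ∃ f : V → ℕ, PropOn G f S ∧ ∀ v ∈ S, f v < cn G S := by
  have hne : {n : ℕ | (G.induce (S : Set V)).Colorable n}.Nonempty :=
    ⟨_, (G.induce (S : Set V)).selfColoring.colorable⟩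
  obtain ⟨C⟩ := Nat.sInf_mem hne
  refine ⟨fun v => if h : v ∈ S then (C ⟨v, h⟩).1 else 0, ?_, ?_⟩
  · intro u hu v hv huv
    simp only [hu, hv, dif_pos]
    intro heq
    exact C.valid (v := ⟨u, hu⟩) (w := ⟨v, hv⟩) huv (Fin.ext heq)
  · intro v hv
    simp only [hv, dif_pos]
    exact (C ⟨v, hv⟩).2

theorem cn_le_of {f : V → ℕ} {S : Finset V} (h : PropOn G f S) (n : ℕ)
    (hn : ∀ v ∈ S, f v < n) : cn G S ≤ n := by
  refine (cn_le_image G h).trans ?_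
  have : S.image f ⊆ Finset.range n := by
    intro x hx
    obtain ⟨v, hv, rfl⟩ := Finset.mem_image.1 hx
    exact Finset.mem_range.2 (hn v hv)
  simpa using Finset.card_le_card this

theorem cn_mono {S T : Finset V} (h : S ⊆ T) : cn G S ≤ cn G T := by
  obtain ⟨f, hf, hb⟩ := cn_spec G T
  exact cn_le_of G (fun u hu v hv => hf u (h hu) v (h hv)) _ (fun v hv => hb v (h hv))

theorem cn_empty : cn G ∅ = 0 :=
  Nat.le_zero.1 (cn_le_of G (f := fun _ => 0) (by intro u hu; simp at hu) 0 (by simp))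

theorem cn_union (S T : Finset V) : cn G (S ∪ T) ≤ cn G S + cn G T := by
  obtain ⟨f, hf, hfb⟩ := cn_spec G S
  obtain ⟨g, hg, hgb⟩ := cn_spec G T
  apply cn_le_of G (f := fun v => if v ∈ S then f v else cn G S + g v)
  · intro u hu v hv huv
    by_cases h1 : u ∈ S <;> by_cases h2 : v ∈ S <;> simp only [h1, h2, if_true, if_false]
    · exact hf u h1 v h2 huv
    · have := hfb u h1
      omega
    · have := hfb v h2
      omega
    · have := hg u (by simpa [h1] using hu) v (by simpa [h2] using hv) huv
      omega
  · intro v hv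
    by_cases h2 : v ∈ S <;> simp only [h2, if_true, if_false]
    · have := hfb v h2
      omega
    · have := hgb v (by simpa [h2] using hv)
      omega

theorem cn_join {A B : Finset V} (h : JoinS G A B) : cn G A + cn G B ≤ cn G (A ∪ B) := by
  obtain ⟨f, hf, hfb⟩ := cn_spec G (A ∪ B)
  have hA : PropOn G f A := fun u hu v hv =>
    hf u (Finset.mem_union_left _ hu) v (Finset.mem_union_left _ hv)
  have hB : PropOn G f B := fun u hu v hv =>
    hf u (Finset.mem_union_right _ hu) v (Finset.mem_union_right _ hv)
  have hd : Disjoint (A.image f) (B.image f) := by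
    rw [Finset.disjoint_left]
    intro x hx hy
    obtain ⟨a, ha, rfl⟩ := Finset.mem_image.1 hx
    obtain ⟨b, hb, hab⟩ := Finset.mem_image.1 hy
    exact hf a (Finset.mem_union_left _ ha) b (Finset.mem_union_right _ hb) (h a ha b hb) hab.symm
  have hs : A.image f ∪ B.image f ⊆ Finset.range (cn G (A ∪ B)) := by
    intro x hx
    rw [← Finset.image_union] at hx
    obtain ⟨v, hv, rfl⟩ := Finset.mem_image.1 hx
    exact Finset.mem_range.2 (hfb v hv)
  have h1 := Finset.card_le_card hs
  rw [Finset.card_union_of_disjoint hd, Finset.card_range] at h1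
  have h2 := cn_le_image G hA
  have h3 := cn_le_image G hB
  omega

theorem cn_le_one {S : Finset V} (h : ∀ u ∈ S, ∀ v ∈ S, ¬ G.Adj u v) : cn G S ≤ 1 :=
  cn_le_of G (f := fun _ => 0) (fun u hu v hv huv => absurd huv (h u hu v hv)) 1 (by simp)

theorem cn_pos {S : Finset V} (h : S.Nonempty) : 0 < cn G S := by
  obtain ⟨v, hv⟩ := h
  obtain ⟨f, -, hb⟩ := cn_spec G S
  have := hb v hv
  omega

theorem cn_insert (v : V) (S : Finset V) : cn G (insert v S) ≤ cn G S + 1 := by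
  have h1 := cn_union G {v} S
  have h2 : cn G {v} ≤ 1 := cn_le_one G (by simp)
  rw [← Finset.insert_eq] at h1
  omega

theorem cn_biUnion_le {ι : Type*} (F : Finset ι) (t : ι → Finset V) :
    cn G (F.biUnion t) ≤ ∑ A ∈ F, cn G (t A) := by
  induction F using Finset.induction_on with
  | empty => simp [cn_empty]
  | insert a F ha ih =>
    rw [Finset.biUnion_insert, Finset.sum_insert ha]
    have := cn_union G (t a) (F.biUnion t)
    omega

theorem cn_biUnion_join (F : Finset (Finset V))
    (h : ∀ A ∈ F, ∀ B ∈ F, A ≠ B → JoinS G A B) :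
    ∑ A ∈ F, cn G A ≤ cn G (F.biUnion id) := by
  induction F using Finset.induction_on with
  | empty => simp
  | insert a F ha ih =>
    rw [Finset.biUnion_insert, Finset.sum_insert ha]
    have h1 := ih (fun A hA B hB => h A (Finset.mem_insert_of_mem hA) B (Finset.mem_insert_of_mem hB))
    have h2 : JoinS G (id a) (F.biUnion id) := by
      intro x hx y hy
      obtain ⟨B, hB, hyB⟩ := Finset.mem_biUnion.1 hy
      refine h a (Finset.mem_insert_self _ _) B (Finset.mem_insert_of_mem hB) ?_ x hx y hyB
      rintro rfl
      exact ha hB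
    have h3 := cn_join G h2
    simp only [id] at h3 ⊢
    omega

theorem hall_on {β : Type*} [Inhabited β] [DecidableEq β] (O : Finset V) (t : V → Finset β)
    (h : ∀ T ⊆ O, T.card ≤ (T.biUnion t).card) :
    ∃ f : V → β, Set.InjOn f O ∧ ∀ x ∈ O, f x ∈ t x := by
  obtain ⟨f, hf, hft⟩ := (Finset.all_card_le_biUnion_card_iff_exists_injective
    (fun x : {x // x ∈ O} => t x.1)).1 (by
      intro s
      have h1 := h (s.image Subtype.val) (by
        intro x hx
        obtain ⟨y, -, rfl⟩ := Finset.mem_image.1 hx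
        exact y.2)
      rw [Finset.card_image_of_injective _ Subtype.val_injective, Finset.image_biUnion] at h1
      exact h1)
  refine ⟨fun x => if hx : x ∈ O then f ⟨x, hx⟩ else default, ?_, ?_⟩
  · intro x hx y hy hxy
    have hx' : x ∈ O := hx
    have hy' : y ∈ O := hy
    simp only [hx', hy', dif_pos] at hxy
    exact congrArg Subtype.val (hf hxy)
  · intro x hx
    simp only [hx, dif_pos]
    exact hft ⟨x, hx⟩

theorem cn_match (F : Finset (Finset V)) (hcrit : ∀ A ∈ F, ∀ w ∈ A, cn G (A.erase w) < cn G A)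
    (O : Finset V) (f : V → Finset V) (hf : Set.InjOn f O) (hF : ∀ o ∈ O, f o ∈ F)
    (hw : ∀ o ∈ O, ∃ w ∈ f o, ¬ G.Adj o w) :
    cn G (F.biUnion id ∪ O) ≤ ∑ A ∈ F, cn G A := by
  have hsub : F.biUnion id ∪ O ⊆ F.biUnion (fun A => A ∪ O.filter (fun o => f o = A)) := by
    intro x hx
    rcases Finset.mem_union.1 hx with hx | hx
    · obtain ⟨A, hA, hxA⟩ := Finset.mem_biUnion.1 hx
      exact Finset.mem_biUnion.2 ⟨A, hA, Finset.mem_union_left _ hxA⟩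
    · exact Finset.mem_biUnion.2 ⟨f x, hF x hx, Finset.mem_union_right _ (by simp [hx])⟩
  refine (cn_mono G hsub).trans ((cn_biUnion_le G _ _).trans ?_)
  apply Finset.sum_le_sum
  intro A hA
  by_cases he : ∃ o ∈ O, f o = A
  · obtain ⟨o, ho, rfl⟩ := he
    obtain ⟨w, hwA, hadj⟩ := hw o ho
    have hs : f o ∪ O.filter (fun o' => f o' = f o) ⊆ {o, w} ∪ (f o).erase w := by
      intro x hx
      rcases Finset.mem_union.1 hx with hx | hx
      · by_cases hxw : x = w
        · simp [hxw]
        · exact Finset.mem_union_right _ (Finset.mem_erase.2 ⟨hxw, hx⟩)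
      · obtain ⟨hxO, hxf⟩ := Finset.mem_filter.1 hx
        have := hf hxO ho hxf
        simp [this]
    have h1 := (cn_mono G hs).trans (cn_union G _ _)
    have h2 : cn G {o, w} ≤ 1 := by
      apply cn_le_one
      intro u hu v hv huv
      simp only [Finset.mem_insert, Finset.mem_singleton] at hu hv
      rcases hu with rfl | rfl <;> rcases hv with rfl | rfl
      · exact G.loopless.irrefl _ huv
      · exact hadj huv
      · exact hadj huv.symm
      · exact G.loopless.irrefl _ huv
    have h3 := hcrit _ hA w hwA
    omega
  · have : O.filter (fun o => f o = A) = ∅ := by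
      rw [Finset.filter_eq_empty_iff]
      intro o ho h
      exact he ⟨o, ho, h⟩
    rw [this, Finset.union_empty]

/-- Joined family of critical sets `A` with `|A| ≥ 2χ(A) - 1`. -/
structure GoodFam (F : Finset (Finset V)) : Prop where
  pair : ∀ A ∈ F, ∀ B ∈ F, A ≠ B → JoinS G A B
  crit : ∀ A ∈ F, ∀ w ∈ A, cn G (A.erase w) < cn G A
  size : ∀ A ∈ F, 2 * cn G A ≤ A.card + 1
  ne : ∀ A ∈ F, A.Nonempty

theorem good_card {F : Finset (Finset V)} (hF : GoodFam G F) :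
    (F.biUnion id).card = ∑ A ∈ F, A.card := by
  rw [Finset.card_biUnion]
  · rfl
  · intro A hA B hB hAB
    rw [Function.onFun, Finset.disjoint_left]
    intro x hx hy
    exact G.loopless.irrefl _ (hF.pair A hA B hB hAB x hx x hy)

/-- Gallai's bound for critical graphs which are not joins. -/
theorem gallai_step (S : Finset V) (hcrit : ∀ w ∈ S, cn G (S.erase w) < cn G S)
    (hns : ¬ ∃ A B : Finset V, A ∪ B = S ∧ A.Nonempty ∧ B.Nonempty ∧ JoinS G A B)
    (v : V) (hv : v ∈ S) (F : Finset (Finset V)) (hF : GoodFam G F)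
    (hsub : ∀ A ∈ F, A ⊆ S.erase v) (hsum : cn G (S.erase v) = ∑ A ∈ F, cn G A) :
    2 * cn G S ≤ S.card + 1 := by
  obtain ⟨U, hU⟩ : ∃ U, U = F.biUnion id := ⟨_, rfl⟩
  have hUS : U ⊆ S.erase v := by
    rw [hU]
    exact Finset.biUnion_subset.2 hsub
  have hUS' : U ⊆ S := hUS.trans (Finset.erase_subset _ _)
  obtain ⟨O, hO⟩ : ∃ O, O = S \ U := ⟨_, rfl⟩
  have hvO : v ∈ O := by
    rw [hO, Finset.mem_sdiff]
    exact ⟨hv, fun h => (Finset.mem_erase.1 (hUS h)).1 rfl⟩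
  have hUO : U ∪ O = S := by
    rw [hO]
    exact Finset.union_sdiff_of_subset hUS'
  have hdisj : Disjoint U O := by
    rw [hO]
    exact Finset.disjoint_sdiff
  obtain ⟨t, ht⟩ : ∃ t : V → Finset (Finset V),
    t = fun o => F.filter (fun A => ∃ w ∈ A, ¬ G.Adj o w) := ⟨_, rfl⟩
  have htm : ∀ o A, A ∈ t o ↔ A ∈ F ∧ ∃ w ∈ A, ¬ G.Adj o w := by
    intro o A
    rw [ht]
    simp
  obtain ⟨P, hP, hmax⟩ := Finset.exists_max_image O.powerset
    (fun T => (T.card : ℤ) - ((T.biUnion t).card : ℤ)) ⟨∅, by simp⟩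
  rw [Finset.mem_powerset] at hP
  have hcS := hcrit v hv
  -- the families
  obtain ⟨C2, hC2⟩ : ∃ C, C = P.biUnion t := ⟨_, rfl⟩
  have hC2F : C2 ⊆ F := by
    rw [hC2]
    refine Finset.biUnion_subset.2 ?_
    intro o _ A hA
    exact ((htm o A).1 hA).1
  obtain ⟨C1, hC1⟩ : ∃ C, C = F \ C2 := ⟨_, rfl⟩
  have hC1F : C1 ⊆ F := by
    rw [hC1]
    exact Finset.sdiff_subset
  have hC12 : ∀ A ∈ F, A ∈ C1 ∨ A ∈ C2 := by
    intro A hA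
    rw [hC1, Finset.mem_sdiff]
    tauto
  obtain ⟨f, hfinj, hft⟩ := hall_on (O \ P) (fun o => t o \ C2) (by
    intro T hT
    have hTO : T ⊆ O := hT.trans Finset.sdiff_subset
    have hm := hmax (P ∪ T) (Finset.mem_powerset.2 (Finset.union_subset hP hTO))
    have hd : Disjoint P T := by
      rw [Finset.disjoint_right]
      intro x hx
      exact (Finset.mem_sdiff.1 (hT hx)).2
    have he : (P ∪ T).biUnion t ⊆ C2 ∪ T.biUnion (fun o => t o \ C2) := by
      intro A hA
      obtain ⟨o, ho, hoA⟩ := Finset.mem_biUnion.1 hA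
      by_cases hA2 : A ∈ C2
      · exact Finset.mem_union_left _ hA2
      · rcases Finset.mem_union.1 ho with ho | ho
        · exact absurd (by rw [hC2]; exact Finset.mem_biUnion.2 ⟨o, ho, hoA⟩) hA2
        · exact Finset.mem_union_right _
            (Finset.mem_biUnion.2 ⟨o, ho, Finset.mem_sdiff.2 ⟨hoA, hA2⟩⟩)
    have h1 := (Finset.card_le_card he).trans (Finset.card_union_le _ _)
    simp only [Finset.card_union_of_disjoint hd] at hm
    rw [← hC2] at hm
    push_cast at hm
    omega)
  have hm1 := cn_match G C1 (fun A hA => hF.crit A (hC1F hA)) (O \ P) f hfinj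
    (by
      intro o ho
      have h := Finset.mem_sdiff.1 (hft o ho)
      rw [hC1]
      exact Finset.mem_sdiff.2 ⟨((htm _ _).1 h.1).1, h.2⟩)
    (by
      intro o ho
      have h := Finset.mem_sdiff.1 (hft o ho)
      exact ((htm _ _).1 h.1).2)
  obtain ⟨R, hR⟩ : ∃ R, R = C2.biUnion id ∪ P := ⟨_, rfl⟩
  have hC1U : C1.biUnion id ⊆ U := by
    rw [hU]
    exact Finset.biUnion_subset_biUnion_of_subset_left _ hC1F
  have hC2U : C2.biUnion id ⊆ U := by
    rw [hU]
    exact Finset.biUnion_subset_biUnion_of_subset_left _ hC2F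
  have hSsub : S ⊆ (C1.biUnion id ∪ (O \ P)) ∪ R := by
    intro x hx
    rw [← hUO] at hx
    rcases Finset.mem_union.1 hx with hx | hx
    · rw [hU] at hx
      obtain ⟨A, hA, hxA⟩ := Finset.mem_biUnion.1 hx
      rcases hC12 A hA with h | h
      · exact Finset.mem_union_left _ (Finset.mem_union_left _ (Finset.mem_biUnion.2 ⟨A, h, hxA⟩))
      · rw [hR]
        exact Finset.mem_union_right _ (Finset.mem_union_left _ (Finset.mem_biUnion.2 ⟨A, h, hxA⟩))
    · by_cases hxP : x ∈ P
      · rw [hR]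
        exact Finset.mem_union_right _ (Finset.mem_union_right _ hxP)
      · exact Finset.mem_union_left _ (Finset.mem_union_right _ (Finset.mem_sdiff.2 ⟨hx, hxP⟩))
  have hle := (cn_mono G hSsub).trans (cn_union G _ _)
  have hj : JoinS G (C1.biUnion id) R := by
    intro a ha b hb
    obtain ⟨A, hA, haA⟩ := Finset.mem_biUnion.1 ha
    have hA2 : A ∉ C2 := by
      rw [hC1] at hA
      exact (Finset.mem_sdiff.1 hA).2
    rw [hR] at hb
    rcases Finset.mem_union.1 hb with hb | hb
    · obtain ⟨B, hB, hbB⟩ := Finset.mem_biUnion.1 hb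
      refine hF.pair A (hC1F hA) B (hC2F hB) ?_ a haA b hbB
      rintro rfl
      exact hA2 hB
    · by_contra hadj
      apply hA2
      rw [hC2]
      exact Finset.mem_biUnion.2 ⟨b, hb, (htm _ _).2 ⟨hC1F hA, a, haA, fun h => hadj h.symm⟩⟩
  have hjc := cn_join G hj
  have hjs := cn_biUnion_join G C1
    (fun A hA B hB => hF.pair A (hC1F hA) B (hC1F hB))
  have hRS : R ⊆ S := by
    rw [hR]
    refine Finset.union_subset (hC2U.trans hUS') (hP.trans ?_)
    rw [hO]
    exact Finset.sdiff_subset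
  have hPO : P = O := by
    refine Finset.Subset.antisymm hP ?_
    intro o ho
    by_contra hoP
    have hoU : o ∉ U := Finset.disjoint_right.1 hdisj ho
    have hoS : o ∈ S := by
      rw [← hUO]
      exact Finset.mem_union_right _ ho
    have h1 := hcrit o hoS
    have h2 : C1.biUnion id ∪ R ⊆ S.erase o := by
      intro x hx
      rw [Finset.mem_erase]
      constructor
      · rintro rfl
        rcases Finset.mem_union.1 hx with hx | hx
        · exact hoU (hC1U hx)
        · rw [hR] at hx
          rcases Finset.mem_union.1 hx with hx | hx
          · exact hoU (hC2U hx)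
          · exact hoP hx
      · rcases Finset.mem_union.1 hx with hx | hx
        · exact hUS' (hC1U hx)
        · exact hRS hx
    have h3 := cn_mono G h2
    omega
  have hC1e : C1 = ∅ := by
    by_contra hne
    obtain ⟨A, hA⟩ := Finset.nonempty_iff_ne_empty.2 hne
    obtain ⟨a, ha⟩ := hF.ne A (hC1F hA)
    apply hns
    refine ⟨C1.biUnion id, R, ?_, ⟨a, Finset.mem_biUnion.2 ⟨A, hA, ha⟩⟩, ⟨v, ?_⟩, hj⟩
    · apply Finset.Subset.antisymm (Finset.union_subset (hC1U.trans hUS') hRS)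
      rw [hPO] at hSsub
      simpa using hSsub
    · rw [hR, hPO]
      exact Finset.mem_union_right _ hvO
  have hC2e : C2 = F := by
    apply Finset.Subset.antisymm hC2F
    intro A hA
    rcases hC12 A hA with h | h
    · rw [hC1e] at h
      simp at h
    · exact h
  have hcard : F.card + 1 ≤ O.card := by
    by_contra hlt
    obtain ⟨g, hginj, hgt⟩ := hall_on O t (by
      intro T hT
      have hm := hmax T (Finset.mem_powerset.2 hT)
      rw [← hC2, hC2e, hPO] at hm
      omega)
    have h1 := cn_match G F hF.crit O g hginj
      (fun o ho => ((htm _ _).1 (hgt o ho)).1) (fun o ho => ((htm _ _).1 (hgt o ho)).2)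
    rw [← hU, hUO] at h1
    omega
  have hUc := good_card G hF
  rw [← hU] at hUc
  have h1 : ∑ A ∈ F, 2 * cn G A ≤ ∑ A ∈ F, (A.card + 1) := Finset.sum_le_sum hF.size
  rw [← Finset.mul_sum, Finset.sum_add_distrib, ← hUc, ← hsum] at h1
  simp only [Finset.sum_const, smul_eq_mul, mul_one] at h1
  have h2 := cn_insert G v (S.erase v)
  rw [Finset.insert_erase hv] at h2
  have h3 : S.card = U.card + O.card := by
    rw [← hUO, Finset.card_union_of_disjoint hdisj]
  omega

theorem decomp (S : Finset V) : ∃ F : Finset (Finset V), GoodFam G F ∧ (∀ A ∈ F, A ⊆ S) ∧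
    cn G S = ∑ A ∈ F, cn G A := by
  induction S using Finset.strongInduction with
  | H S ih =>
  by_cases hcrit : ∀ w ∈ S, cn G (S.erase w) < cn G S
  swap
  · push Not at hcrit
    obtain ⟨w, hw, hle⟩ := hcrit
    obtain ⟨F, hF, hs, hc⟩ := ih (S.erase w) (Finset.erase_ssubset hw)
    refine ⟨F, hF, fun A hA => (hs A hA).trans (Finset.erase_subset _ _), ?_⟩
    rw [← hc]
    exact le_antisymm hle (cn_mono G (Finset.erase_subset _ _))
  by_cases hns : ∃ A B : Finset V, A ∪ B = S ∧ A.Nonempty ∧ B.Nonempty ∧ JoinS G A B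
  · obtain ⟨A, B, hAB, ⟨a, ha⟩, ⟨b, hb⟩, hj⟩ := hns
    have hd : ∀ x, x ∈ A → x ∉ B := fun x hx hy => G.loopless.irrefl _ (hj x hx x hy)
    have hA : A ⊂ S := by
      rw [← hAB]
      refine ⟨Finset.subset_union_left, fun h => ?_⟩
      exact hd b (h (Finset.mem_union_right _ hb)) hb
    have hB : B ⊂ S := by
      rw [← hAB]
      refine ⟨Finset.subset_union_right, fun h => ?_⟩
      exact hd a ha (h (Finset.mem_union_left _ ha))
    obtain ⟨F1, hF1, hs1, hc1⟩ := ih A hA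
    obtain ⟨F2, hF2, hs2, hc2⟩ := ih B hB
    refine ⟨F1 ∪ F2, ⟨?_, ?_, ?_, ?_⟩, ?_, ?_⟩
    · intro X hX Y hY hXY
      rcases Finset.mem_union.1 hX with hX | hX <;> rcases Finset.mem_union.1 hY with hY | hY
      · exact hF1.pair X hX Y hY hXY
      · exact fun x hx y hy => hj x (hs1 X hX hx) y (hs2 Y hY hy)
      · exact fun x hx y hy => (hj y (hs1 Y hY hy) x (hs2 X hX hx)).symm
      · exact hF2.pair X hX Y hY hXY
    · intro X hX
      rcases Finset.mem_union.1 hX with hX | hX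
      · exact hF1.crit X hX
      · exact hF2.crit X hX
    · intro X hX
      rcases Finset.mem_union.1 hX with hX | hX
      · exact hF1.size X hX
      · exact hF2.size X hX
    · intro X hX
      rcases Finset.mem_union.1 hX with hX | hX
      · exact hF1.ne X hX
      · exact hF2.ne X hX
    · intro X hX
      rcases Finset.mem_union.1 hX with hX | hX
      · exact (hs1 X hX).trans hA.1
      · exact (hs2 X hX).trans hB.1
    · have hdis : Disjoint F1 F2 := by
        rw [Finset.disjoint_left]
        intro X hX hY
        obtain ⟨x, hx⟩ := hF1.ne X hX
        exact hd x (hs1 X hX hx) (hs2 X hY hx)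
      rw [Finset.sum_union hdis, ← hc1, ← hc2, ← hAB]
      exact le_antisymm (cn_union G A B) (cn_join G hj)
  · rcases S.eq_empty_or_nonempty with rfl | ⟨v, hv⟩
    · exact ⟨∅, ⟨by simp, by simp, by simp, by simp⟩, by simp, by simp [cn_empty]⟩
    · obtain ⟨F, hF, hs, hc⟩ := ih (S.erase v) (Finset.erase_ssubset hv)
      have := gallai_step G S hcrit hns v hv F hF hs hc
      refine ⟨{S}, ⟨?_, ?_, ?_, ?_⟩, by simp, by simp⟩
      · intro A hA B hB hAB
        rw [Finset.mem_singleton] at hA hB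
        exact absurd (hA.trans hB.symm) hAB
      · intro A hA
        rw [Finset.mem_singleton.1 hA]
        exact hcrit
      · intro A hA
        rw [Finset.mem_singleton.1 hA]
        exact this
      · intro A hA
        rw [Finset.mem_singleton.1 hA]
        exact ⟨v, hv⟩

theorem exists_dominating (X : Finset V) (hX : 3 * X.card < 5 * cn G X) :
    ∃ v ∈ X, cn G X ≤ cn G (X.filter (fun w => w = v ∨ G.Adj v w)) := by
  obtain ⟨F, hF, hs, hc⟩ := decomp G X
  have hUX : F.biUnion id ⊆ X := Finset.biUnion_subset.2 hs
  have hex : ∃ A ∈ F, 3 * A.card < 5 * cn G A := by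
    by_contra hno
    push Not at hno
    have h1 := Finset.sum_le_sum hno
    rw [← Finset.mul_sum, ← Finset.mul_sum, ← hc, ← good_card G hF] at h1
    have h2 := Finset.card_le_card hUX
    omega
  obtain ⟨A, hA, hlt⟩ := hex
  have hsz := hF.size A hA
  have hpos := cn_pos G (hF.ne A hA)
  have hcases : (cn G A = 1 ∧ A.card = 1) ∨ (cn G A = 2 ∧ A.card = 3) := by
    have := (hF.ne A hA).card_pos
    omega
  rcases hcases with ⟨-, h1⟩ | ⟨h2, h3⟩
  · obtain ⟨v, rfl⟩ := Finset.card_eq_one.1 h1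
    refine ⟨v, hs _ hA (Finset.mem_singleton_self v), ?_⟩
    rw [hc]
    refine (cn_biUnion_join G F hF.pair).trans (cn_mono G ?_)
    intro x hx
    rw [Finset.mem_filter]
    refine ⟨hUX hx, ?_⟩
    obtain ⟨B, hB, hxB⟩ := Finset.mem_biUnion.1 hx
    by_cases hBe : B = {v}
    · left
      rw [hBe] at hxB
      exact Finset.mem_singleton.1 hxB
    · right
      exact hF.pair {v} hA B hB (fun h => hBe h.symm) v (Finset.mem_singleton_self v) x hxB
  · exfalso
    have hadj : ∃ a ∈ A, ∃ b ∈ A, G.Adj a b := by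
      by_contra hno
      push Not at hno
      have := cn_le_one G hno
      omega
    obtain ⟨a, ha, b, hb, hab⟩ := hadj
    have hw : ∃ w ∈ A, w ∉ ({a, b} : Finset V) := by
      by_contra hno
      push Not at hno
      have h4 := Finset.card_le_card hno
      have h5 := Finset.card_le_two (a := a) (b := b)
      omega
    obtain ⟨w, hwA, hwn⟩ := hw
    have h6 := hF.crit A hA w hwA
    have h7 : ({a} ∪ {b} : Finset V) ⊆ A.erase w := by
      intro x hx
      simp only [Finset.mem_union, Finset.mem_singleton] at hx
      simp only [Finset.mem_insert, Finset.mem_singleton, not_or] at hwn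
      rw [Finset.mem_erase]
      rcases hx with rfl | rfl
      · exact ⟨fun h => hwn.1 h.symm, ha⟩
      · exact ⟨fun h => hwn.2 h.symm, hb⟩
    have h8 := cn_mono G h7
    have h9 : JoinS G {a} {b} := by
      intro x hx y hy
      rw [Finset.mem_singleton] at hx hy
      rw [hx, hy]
      exact hab
    have h10 := cn_join G h9
    have h11 := cn_pos G (Finset.singleton_nonempty a)
    have h12 := cn_pos G (Finset.singleton_nonempty b)
    omega

theorem cn_univ [Fintype V] : cn G Finset.univ = chromNum G := by
  unfold cn chromNum
  congr 1
  ext n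
  simp only [Set.mem_setOf_eq]
  constructor
  · rintro ⟨C⟩
    exact ⟨Coloring.mk (fun v => C ⟨v, by simp⟩) (fun {u v} huv =>
      C.valid (v := ⟨u, by simp⟩) (w := ⟨v, by simp⟩) huv)⟩
  · rintro ⟨C⟩
    exact ⟨Coloring.mk (fun v => C v.1) (fun {u v} huv => C.valid huv)⟩

theorem le_colDisc [Fintype V] (σ : V → ℕ) (S : Finset V) (z : ℤ)
    (h : z ≤ ((S.image σ).card : ℤ) - (cn G S : ℤ)) : z ≤ colDisc G σ := by
  refine h.trans ?_
  unfold colDisc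
  apply le_csSup
  · refine ⟨(Fintype.card V : ℤ), ?_⟩
    rintro _ ⟨T, rfl⟩
    have h1 : (σ '' T).ncard ≤ T.ncard := Set.ncard_image_le (Set.toFinite T)
    have h2 : T.ncard ≤ Fintype.card V := by
      have := Set.ncard_le_card T
      rwa [Nat.card_eq_fintype_card] at this
    omega
  · refine ⟨(S : Set V), ?_⟩
    rw [← Finset.coe_image, Set.ncard_coe_finset]
    rfl

theorem main_colDisc [Fintype V] [Nonempty V]
    (s : ℕ) (hs : 3 ≤ s) (hco : CoLocallyColorable G (s - 1))
    (hK : ¬ Nonempty (G ≃g (⊤ : SimpleGraph (Fin s))))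
    (hchi : 3 * chromNum G < 5 * s + 2) (σ : V → ℕ) (hσ : IsProperColoring G σ) :
    (chromNum G : ℤ) - s + 1 ≤ colDisc G σ := by
  have hco' : ∀ v u : V, u ≠ v →
      cn G (insert u (Finset.univ.filter (fun w => G.Adj v w))) ≤ s - 1 := by
    intro v u huv
    have h := hco v u huv
    have he : ((insert u (Finset.univ.filter (fun w => G.Adj v w)) : Finset V) : Set V)
        = insert u (G.neighborSet v) := by
      ext x
      simp
    unfold cn
    rw [he]
    exact h
  by_cases hsmall : chromNum G + 1 ≤ s
  · apply le_colDisc G σ ∅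
    rw [cn_empty]
    simp
    omega
  obtain ⟨k, hk⟩ : ∃ k, k = (Finset.univ.image σ).card := ⟨_, rfl⟩
  have hPσ : PropOn G σ Finset.univ := fun u _ v _ huv => hσ huv
  have hkχ : chromNum G ≤ k := by
    rw [← cn_univ, hk]
    exact cn_le_image G hPσ
  rcases Nat.eq_or_lt_of_le hkχ with heq | hlt
  · -- exactly `χ` colours
    by_cases hinj : Function.Injective σ
    · exfalso
      have hcard : Fintype.card V = chromNum G := by
        rw [heq, hk, Finset.card_image_of_injective _ hinj, Finset.card_univ]
      have htop : ∀ a b : V, a ≠ b → G.Adj a b := by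
        intro a b hab
        by_contra hn
        have hP : PropOn G (fun x => if x = b then σ a else σ x) Finset.univ := by
          intro u _ v _ huv
          by_cases h1 : u = b <;> by_cases h2 : v = b <;> simp only [h1, h2, if_true, if_false]
          · subst h1
            subst h2
            exact absurd huv (G.loopless.irrefl _)
          · intro h
            have := hinj h
            subst this
            subst h1
            exact hn huv.symm
          · intro h
            have := hinj h
            subst this
            subst h2
            exact hn huv
          · exact hσ huv
        have h1 := cn_le_image G hP
        have h2 : Finset.univ.image (fun x => if x = b then σ a else σ x) ⊆
            (Finset.univ.image σ).erase (σ b) := by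
          intro x hx
          obtain ⟨y, -, rfl⟩ := Finset.mem_image.1 hx
          rw [Finset.mem_erase]
          by_cases hy : y = b
          · simp only [hy, if_true]
            exact ⟨fun h => hab (hinj h), by simp⟩
          · simp only [hy, if_false]
            exact ⟨fun h => hy (hinj h), by simp⟩
        have h3 := Finset.card_le_card h2
        rw [Finset.card_erase_of_mem (by simp), ← hk] at h3
        rw [cn_univ] at h1
        omega
      have hle : chromNum G ≤ s := by
        have hc2 : 1 < Fintype.card V := by omega
        obtain ⟨u, v, huv⟩ := Fintype.exists_pair_of_one_lt_card hc2
        have h1 := hco' v u huv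
        have h2 := cn_insert G v (insert u (Finset.univ.filter (fun w => G.Adj v w)))
        have h3 : insert v (insert u (Finset.univ.filter (fun w => G.Adj v w))) = Finset.univ := by
          ext x
          simp only [Finset.mem_insert, Finset.mem_filter, Finset.mem_univ, true_and, iff_true]
          by_cases hx : x = v
          · exact Or.inl hx
          · exact Or.inr (Or.inr (htop v x (fun h => hx h.symm)))
        rw [h3, cn_univ] at h2
        omega
      apply hK
      have hcs : Fintype.card V = s := by omega
      refine ⟨⟨Fintype.equivFinOfCardEq hcs, ?_⟩⟩
      intro a b
      simp only [SimpleGraph.top_adj, ne_eq, EmbeddingLike.apply_eq_iff_eq]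
      exact ⟨fun h => htop a b h, fun h => h.ne⟩
    · have : ∃ a b, σ a = σ b ∧ a ≠ b := by
        simpa [Function.Injective] using hinj
      obtain ⟨a, b, hab, hne⟩ := this
      have hb : ∃ v, σ v = σ a ∧ ∀ i ∈ Finset.univ.image σ, i ≠ σ a → ∃ w, G.Adj v w ∧ σ w = i := by
        by_contra hno
        push Not at hno
        choose g hg1 hg2 hg3 using hno
        have hP : PropOn G (fun x => if h : σ x = σ a then g x h else σ x) Finset.univ := by
          intro u _ v _ huv
          by_cases h1 : σ u = σ a <;> by_cases h2 : σ v = σ a <;>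
            simp only [h1, h2, dif_pos, dif_neg, not_false_iff]
          · exact absurd (h1.trans h2.symm) (hσ huv)
          · exact fun h => hg3 u h1 v huv h.symm
          · exact fun h => hg3 v h2 u huv.symm h
          · exact hσ huv
        have h1 := cn_le_image G hP
        have h2 : Finset.univ.image (fun x => if h : σ x = σ a then g x h else σ x) ⊆
            (Finset.univ.image σ).erase (σ a) := by
          intro x hx
          obtain ⟨y, -, rfl⟩ := Finset.mem_image.1 hx
          rw [Finset.mem_erase]
          by_cases hy : σ y = σ a
          · simp only [hy, dif_pos]
            exact ⟨hg2 y hy, hg1 y hy⟩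
          · simp only [hy, dif_neg, not_false_iff]
            exact ⟨hy, by simp⟩
        have h3 := Finset.card_le_card h2
        rw [Finset.card_erase_of_mem (by simp), ← hk] at h3
        rw [cn_univ] at h1
        omega
      obtain ⟨v, hva, hv⟩ := hb
      have hu : ∃ u, u ≠ v ∧ σ u = σ a := by
        by_cases h : a = v
        · exact ⟨b, fun h' => hne (h.trans h'.symm), hab.symm⟩
        · exact ⟨a, h, rfl⟩
      obtain ⟨u, huv, hua⟩ := hu
      have h1 := hco' v u huv
      apply le_colDisc G σ (insert u (Finset.univ.filter (fun w => G.Adj v w)))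
      have h2 : Finset.univ.image σ ⊆
          (insert u (Finset.univ.filter (fun w => G.Adj v w))).image σ := by
        intro i hi
        rw [Finset.mem_image]
        by_cases hia : i = σ a
        · exact ⟨u, by simp, hua.trans hia.symm⟩
        · obtain ⟨w, hw, rfl⟩ := hv i hi hia
          exact ⟨w, by simp [hw], rfl⟩
      have h3 := Finset.card_le_card h2
      omega
  · -- more than `χ` colours
    obtain ⟨X, -, hXi, hXinj⟩ : ∃ X : Finset V, X ⊆ Finset.univ ∧
        X.image σ = Finset.univ.image σ ∧ X.card = k := by
      have hch : ∀ i ∈ Finset.univ.image σ, ∃ v, σ v = i := by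
        intro i hi
        obtain ⟨v, -, h⟩ := Finset.mem_image.1 hi
        exact ⟨v, h⟩
      choose! g hg using hch
      have him : ((Finset.univ.image σ).image g).image σ = Finset.univ.image σ := by
        ext i
        constructor
        · intro h
          obtain ⟨y, -, rfl⟩ := Finset.mem_image.1 h
          simp
        · intro h
          exact Finset.mem_image.2 ⟨g i, Finset.mem_image_of_mem _ h, hg i h⟩
      refine ⟨(Finset.univ.image σ).image g, Finset.subset_univ _, him, ?_⟩
      apply le_antisymm
      · rw [hk]
        exact Finset.card_image_le
      · rw [hk, ← him]
        refine Finset.card_image_le.trans ?_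
        rw [him]
    apply le_colDisc G σ X
    rw [hXi, ← hk]
    by_contra hbad
    have hbig : s + k ≤ cn G X + chromNum G := by omega
    obtain ⟨v, hvX, hv⟩ := exists_dominating G X (by omega)
    have hu : ∃ u, u ≠ v := by
      have : 1 < X.card := by omega
      obtain ⟨u, -, hu⟩ := Finset.exists_mem_ne this v
      exact ⟨u, hu⟩
    obtain ⟨u, hu⟩ := hu
    have h1 := hco' v u hu
    have h2 := cn_insert G v (insert u (Finset.univ.filter (fun w => G.Adj v w)))
    have h3 : X.filter (fun w => w = v ∨ G.Adj v w) ⊆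
        insert v (insert u (Finset.univ.filter (fun w => G.Adj v w))) := by
      intro x hx
      rcases (Finset.mem_filter.1 hx).2 with h | h
      · simp [h]
      · simp [h]
    have h4 := cn_mono G h3
    omega

end Helpers

/-- For every integer `s ≥ 3`, every finite co-locally `(s-1)`-colourable
graph `G` with at least one vertex, not isomorphic to `K_s`, with `χ(G) < (5s+2)/3`,
satisfies `φ(G) ≥ χ(G) - s + 1`. -/
theorem coLocallyColourable_chromDisc {V : Type*} [Fintype V] [Nonempty V]
    (s : ℕ) (hs : 3 ≤ s) (G : SimpleGraph V) (hco : CoLocallyColorable G (s - 1))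
    (hK : ¬ Nonempty (G ≃g (⊤ : SimpleGraph (Fin s))))
    (hchi : (chromNum G : ℝ) < (5 * s + 2) / 3) :
    chromDisc G ≥ (chromNum G : ℤ) - s + 1 := by
  have hchi' : 3 * chromNum G < 5 * s + 2 := by
    have h : (3 * chromNum G : ℝ) < 5 * s + 2 := by linarith
    exact_mod_cast h
  unfold chromDisc
  apply le_csInf
  · refine ⟨_, fun v => (Fintype.equivFin V v).1, ?_, rfl⟩
    intro u v huv h
    exact huv.ne ((Fintype.equivFin V).injective (Fin.ext h))
  · rintro _ ⟨σ, hσ, rfl⟩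
    exact main_colDisc G s hs hco hK hchi' σ hσ
end

section
/- For all integers s₁, s₂ ≥ 2 the following holds. Let G be a finite simple graph with at least one vertex that is 1-locally s₁-colourable and 2-locally s₂-colourable, let k ≥ 0 be an integer, let p = χ(G) + k, and let σ be a proper colouring of G using exactly p colours. Then G has an independent set I whose vertices receive pairwise distinct colours under σ and whose size satisfies |I| ≥ p − p^{1 − 1/(3·s₁·s₂)} − ((k+1)/s₂)·p^{1/3} (as an inequality of real numbers). -/
open SimpleGraph

/-- `W` can be properly coloured with colours `< n`. -/
def ColSet {V : Type*} (G : SimpleGraph V) (W : Set V) (n : ℕ) : Prop :=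
  ∃ f : V → ℕ, (∀ v ∈ W, f v < n) ∧ ∀ u ∈ W, ∀ v ∈ W, G.Adj u v → f u ≠ f v

lemma colSet_of_colorable {V : Type*} {G : SimpleGraph V} {W : Set V} {n : ℕ}
    (h : (G.induce W).Colorable n) : ColSet G W n := by
  classical
  obtain ⟨c⟩ := h
  refine ⟨fun v => if hv : v ∈ W then (c ⟨v, hv⟩ : ℕ) else 0, ?_, ?_⟩
  · intro v hv
    simp [hv]
  · intro u hu v hv huv
    simp only [hu, hv, dif_pos]
    intro hh
    have : (G.induce W).Adj ⟨u, hu⟩ ⟨v, hv⟩ := huv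
    exact c.valid this (Fin.ext hh)

lemma chromNum_le_of_colSet {V : Type*} {G : SimpleGraph V} {n : ℕ}
    (h : ColSet G Set.univ n) : chromNum G ≤ n := by
  obtain ⟨f, h1, h2⟩ := h
  apply Nat.sInf_le
  refine ⟨Coloring.mk (fun v => (⟨f v, h1 v trivial⟩ : Fin n)) ?_⟩
  intro u v huv hh
  exact h2 u trivial v trivial huv (by simpa using hh)

lemma colorable_chromNum {V : Type*} [Finite V] (G : SimpleGraph V) :
    G.Colorable (chromNum G) := by
  classical
  have := Fintype.ofFinite V
  exact Nat.sInf_mem (s := {n : ℕ | G.Colorable n}) ⟨_, G.colorable_of_fintype⟩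

lemma colSet_ball {V : Type*} [Finite V] {G : SimpleGraph V} {r s : ℕ}
    (h : RLocallyColorable G r s) (v : V) : ColSet G (ballSet G v r) s :=
  colSet_of_colorable ((colorable_chromNum _).mono (h v))

lemma ColSet.union {V : Type*} {G : SimpleGraph V} {A B W : Set V} {a b : ℕ}
    (hA : ColSet G A a) (hB : ColSet G B b) (hW : W ⊆ A ∪ B) : ColSet G W (a + b) := by
  classical
  obtain ⟨f, f1, f2⟩ := hA
  obtain ⟨g, g1, g2⟩ := hB
  have key : ∀ v ∈ W, v ∉ A → v ∈ B := fun v hv h => (hW hv).resolve_left h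
  refine ⟨fun v => if v ∈ A then f v else a + g v, ?_, ?_⟩
  · intro v hv
    by_cases h : v ∈ A
    · have := f1 v h
      simp only [h, if_true]; omega
    · have := g1 v (key v hv h)
      simp only [h, if_false]; omega
  · intro u hu v hv huv
    by_cases h : u ∈ A <;> by_cases h' : v ∈ A
    · simpa [h, h'] using f2 u h v h' huv
    · have := f1 u h
      simp only [h, h', if_true, if_false]; omega
    · have := f1 v h'
      simp only [h, h', if_true, if_false]; omega
    · simpa [h, h'] using g2 u (key u hu h) v (key v hv h') huv

/-- an injective-on-`D` relabelling into an initial segment -/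
lemma exists_index (D : Finset ℕ) :
    ∃ e : ℕ → ℕ, (∀ c ∈ D, e c < D.card) ∧ ∀ a ∈ D, ∀ b ∈ D, e a = e b → a = b := by
  classical
  refine ⟨fun c => if h : c ∈ D then (D.equivFin ⟨c, h⟩ : ℕ) else 0, ?_, ?_⟩
  · intro c hc
    simp [hc]
  · intro a ha b hb h
    simp only [ha, hb, dif_pos] at h
    have := D.equivFin.injective (Fin.ext h)
    simpa using this

lemma colSet_of_values {V : Type*} {G : SimpleGraph V} {W : Set V} (D : Finset ℕ) (f : V → ℕ)
    (h1 : ∀ v ∈ W, f v ∈ D) (h2 : ∀ u ∈ W, ∀ v ∈ W, G.Adj u v → f u ≠ f v) :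
    ColSet G W D.card := by
  obtain ⟨e, e1, e2⟩ := exists_index D
  exact ⟨fun v => e (f v), fun v hv => e1 _ (h1 v hv),
    fun u hu v hv huv h => h2 u hu v hv huv (e2 _ (h1 u hu) _ (h1 v hv) h)⟩

/-- The recolouring argument: some closed neighbourhood sees a whole block of colours. -/
lemma exists_block {V : Type*} {G : SimpleGraph V} {W : Set V} {c K m : ℕ} (idx : V → ℕ)
    (hm : 1 ≤ m) (hmc : (K + 1) * m ≤ c)
    (h1 : ∀ v ∈ W, idx v < c) (h2 : ∀ u ∈ W, ∀ v ∈ W, G.Adj u v → idx u ≠ idx v)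
    (hW : ∀ n, ColSet G W n → c ≤ n + K) :
    ∃ v ∈ W, ∃ g, ∀ j, g * m ≤ j → j < g * m + m →
      ∃ u ∈ W, (u = v ∨ G.Adj v u) ∧ idx u = j := by
  classical
  by_contra hcon
  push Not at hcon
  choose! J hJ1 hJ2 hJ3 using hcon
  have hJne : ∀ v ∈ W, ∀ g, idx v = g * m → J v g ≠ g * m := by
    intro v hv g hg h
    exact hJ3 v hv g v hv (Or.inl rfl) (by rw [hg, h])
  set f : V → ℕ := fun v => if m ∣ idx v ∧ idx v / m ≤ K then J v (idx v / m) else idx v with hf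
  set R : Finset ℕ := (Finset.range (K + 1)).image (· * m) with hR
  have hRc : R.card = K + 1 := by
    rw [hR, Finset.card_image_of_injective _
      (fun a b hab => Nat.eq_of_mul_eq_mul_right (by omega) hab),
      Finset.card_range]
  have hRsub : R ⊆ Finset.range c := by
    intro x hx
    simp only [hR, Finset.mem_image, Finset.mem_range] at hx ⊢
    obtain ⟨g, hg, rfl⟩ := hx
    nlinarith
  have hcol : ColSet G W ((Finset.range c) \ R).card := by
    apply colSet_of_values _ f
    · intro v hv
      simp only [Finset.mem_sdiff, Finset.mem_range, hf]
      split_ifs with h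
      · obtain ⟨⟨g, hg⟩, h'⟩ := h
        have hgm : idx v / m = g := by rw [hg]; exact Nat.mul_div_cancel_left _ (by omega)
        rw [hgm] at h' ⊢
        have a1 := hJ1 v hv g
        have a2 := hJ2 v hv g
        have a3 := hJne v hv g (by rw [hg, mul_comm])
        refine ⟨by nlinarith, ?_⟩
        simp only [hR, Finset.mem_image, Finset.mem_range, not_exists, not_and]
        intro g' _ hg'
        rw [← hg'] at a1 a2 a3
        have b1 : g ≤ g' := Nat.le_of_mul_le_mul_right a1 (by omega)
        have b2 : g' < g + 1 := by
          apply Nat.lt_of_mul_lt_mul_right (a := m); linarith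
        have : g' = g := by omega
        exact a3 (by rw [this])
      · refine ⟨h1 v hv, ?_⟩
        simp only [hR, Finset.mem_image, Finset.mem_range, not_exists, not_and]
        intro g hg hgv
        apply h
        rw [← hgv]
        refine ⟨Dvd.intro_left _ rfl, ?_⟩
        rw [Nat.mul_div_cancel _ (by omega)]; omega
    · intro u hu v hv huv
      simp only [hf]
      split_ifs with h h' h'
      · obtain ⟨⟨g, hg⟩, _⟩ := h
        obtain ⟨⟨g', hg'⟩, _⟩ := h'
        have e1 : idx u / m = g := by rw [hg]; exact Nat.mul_div_cancel_left _ (by omega)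
        have e2 : idx v / m = g' := by rw [hg']; exact Nat.mul_div_cancel_left _ (by omega)
        rw [e1, e2]
        intro hh
        have a1 := hJ1 u hu g
        have a2 := hJ2 u hu g
        have a3 := hJ1 v hv g'
        have a4 := hJ2 v hv g'
        have b1 : g < g' + 1 := by
          apply Nat.lt_of_mul_lt_mul_right (a := m); linarith
        have b2 : g' < g + 1 := by
          apply Nat.lt_of_mul_lt_mul_right (a := m); linarith
        have : g = g' := by omega
        exact h2 u hu v hv huv (by rw [hg, hg', this])
      · exact fun hh => hJ3 u hu _ v hv (Or.inr huv) hh.symm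
      · exact fun hh => hJ3 v hv _ u hu (Or.inr huv.symm) hh
      · exact h2 u hu v hv huv
  have := hW _ hcol
  rw [Finset.card_sdiff_of_subset hRsub, hRc, Finset.card_range] at this
  have : K + 1 ≤ c := by nlinarith
  omega

/-- The state of the greedy procedure. -/
structure GState {V : Type*} (G : SimpleGraph V) (σ : V → ℕ) (p K : ℕ)
    (I : Finset V) (W : Set V) (C : Finset ℕ) : Prop where
  indep : ∀ u ∈ I, ∀ v ∈ I, ¬ G.Adj u v
  inj : Set.InjOn σ (↑I : Set V)
  disj : ∀ u ∈ I, σ u ∉ C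
  card : I.card + C.card = p
  sub : ∀ v ∈ W, σ v ∈ C
  sep : ∀ u ∈ I, ∀ v ∈ W, ¬ G.Adj u v
  chi : ∀ n, ColSet G W n → C.card ≤ n + K

lemma GState.step {V : Type*} [Finite V] {G : SimpleGraph V} {σ : V → ℕ} {p K : ℕ}
    {I : Finset V} {W : Set V} {C : Finset ℕ} (S : GState G σ p K I W C)
    (hσ : IsProperColoring G σ) {s₁ s₂ : ℕ}
    (h1 : RLocallyColorable G 1 s₁) (h2 : RLocallyColorable G 2 s₂) :
    ∃ I' W' C', GState G σ p (K + s₂) I' W' C' ∧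
      C.card / (K + 1) + s₁ * C'.card ≤ s₁ * C.card := by
  classical
  rcases Nat.eq_zero_or_pos (C.card / (K + 1)) with h0 | hm
  · refine ⟨I, W, C, ⟨S.indep, S.inj, S.disj, S.card, S.sub, S.sep, ?_⟩, by omega⟩
    intro n hn
    have := S.chi n hn
    omega
  set m := C.card / (K + 1) with hmdef
  obtain ⟨e, e1, e2⟩ := exists_index C
  obtain ⟨v, hv, g, hg⟩ := exists_block (G := G) (W := W) (c := C.card) (K := K) (m := m)
    (fun u => e (σ u)) hm (Nat.mul_div_le _ _) (fun u hu => e1 _ (S.sub u hu))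
    (fun a ha b hb hab h => hσ hab (e2 _ (S.sub a ha) _ (S.sub b hb) h)) S.chi
  haveI : Nonempty V := ⟨v⟩
  choose! r r1 r2 r3 using hg
  -- the rainbow set seen by `v`
  obtain ⟨f, f1, f2⟩ := colSet_ball h1 v
  set T : Finset ℕ := Finset.Ico (g * m) (g * m + m) with hT
  have hTc : T.card = m := by simp [hT]
  have hTm : ∀ j ∈ T, g * m ≤ j ∧ j < g * m + m := fun j hj => by simpa [hT] using hj
  have hball1 : ∀ u, (u = v ∨ G.Adj v u) → u ∈ ballSet G v 1 := by
    rintro u (rfl | h)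
    · exact ⟨Walk.nil, by simp⟩
    · exact ⟨h.toWalk, by simp⟩
  have hball2 : ∀ u w, (u = v ∨ G.Adj v u) → G.Adj u w → w ∈ ballSet G v 2 := by
    rintro u w (rfl | h) h'
    · exact ⟨h'.toWalk, by simp⟩
    · exact ⟨Walk.cons h h'.toWalk, by simp⟩
  have hmaps : ∀ j ∈ T, f (r j) ∈ Finset.range s₁ := fun j hj => by
    have := hTm j hj
    exact Finset.mem_range.2 (f1 _ (hball1 _ (r2 j this.1 this.2)))
  obtain ⟨a, ha⟩ : ∃ a, m ≤ s₁ * (T.filter (fun j => f (r j) = a)).card := by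
    by_contra hcon
    push Not at hcon
    have hs : 0 < s₁ := by
      have : g * m ∈ T := by simp [hT]; omega
      have := hmaps _ this
      simp at this; omega
    have hsum := Finset.card_eq_sum_card_fiberwise hmaps
    have : s₁ * T.card < s₁ * m := by
      rw [hsum, Finset.mul_sum]
      calc _ < ∑ _j ∈ Finset.range s₁, m :=
            Finset.sum_lt_sum_of_nonempty (by simpa using hs.ne') (fun j _ => hcon j)
        _ = s₁ * m := by simp
    rw [hTc] at this
    exact lt_irrefl _ this
  set T' := T.filter (fun j => f (r j) = a) with hT'
  have hT'T : ∀ j ∈ T', g * m ≤ j ∧ j < g * m + m := fun j hj =>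
    hTm j (Finset.mem_filter.1 hj).1
  set J := T'.image r with hJ
  have hJi : Set.InjOn σ (↑J : Set V) := by
    intro x hx y hy hxy
    simp only [hJ, Finset.coe_image, Set.mem_image, Finset.mem_coe] at hx hy
    obtain ⟨i, hi, rfl⟩ := hx
    obtain ⟨j, hj, rfl⟩ := hy
    have p1 := hT'T i hi
    have p2 := hT'T j hj
    have q1 := r3 i p1.1 p1.2
    have q2 := r3 j p2.1 p2.2
    rw [hxy, q2] at q1
    rw [q1]
  have hJc : J.card = T'.card := by
    apply Finset.card_image_of_injOn
    intro i hi j hj hij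
    have p1 := hT'T i hi
    have p2 := hT'T j hj
    have q1 := r3 i p1.1 p1.2
    have q2 := r3 j p2.1 p2.2
    have hij' : r i = r j := hij
    rw [hij', q2] at q1
    exact q1.symm
  have hJW : ∀ u ∈ J, u ∈ W ∧ (u = v ∨ G.Adj v u) ∧ f u = a := by
    intro u hu
    obtain ⟨j, hj, rfl⟩ := Finset.mem_image.1 hu
    have p1 := hT'T j hj
    exact ⟨r1 j p1.1 p1.2, r2 j p1.1 p1.2, (Finset.mem_filter.1 hj).2⟩
  have hJindep : ∀ u ∈ J, ∀ w ∈ J, ¬ G.Adj u w := by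
    intro u hu w hw huw
    have q1 := hJW u hu
    have q2 := hJW w hw
    exact f2 u (hball1 _ q1.2.1) w (hball1 _ q2.2.1) huw (by rw [q1.2.2, q2.2.2])
  set D := J.image σ with hD
  have hDc : D.card = J.card := Finset.card_image_of_injOn hJi
  have hDC : D ⊆ C := by
    intro x hx
    obtain ⟨u, hu, rfl⟩ := Finset.mem_image.1 hx
    exact S.sub u (hJW u hu).1
  have hDle := Finset.card_le_card hDC
  have hcs : (C \ D).card = C.card - D.card := Finset.card_sdiff_of_subset hDC
  have hIJ : Disjoint I J := by
    rw [Finset.disjoint_left]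
    intro u hu hu'
    exact S.disj u hu (S.sub u (hJW u hu').1)
  refine ⟨I ∪ J, {w | w ∈ W ∧ w ∉ ballSet G v 2 ∧ σ w ∉ D}, C \ D, ⟨?_, ?_, ?_, ?_, ?_, ?_, ?_⟩, ?_⟩
  · intro u hu w hw
    rcases Finset.mem_union.1 hu with hu | hu <;> rcases Finset.mem_union.1 hw with hw | hw
    · exact S.indep u hu w hw
    · exact S.sep u hu w (hJW w hw).1
    · exact fun h => S.sep w hw u (hJW u hu).1 h.symm
    · exact hJindep u hu w hw
  · intro u hu w hw huw
    rcases Finset.mem_union.1 (Finset.mem_coe.1 hu) with hu | hu <;>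
      rcases Finset.mem_union.1 (Finset.mem_coe.1 hw) with hw | hw
    · exact S.inj hu hw huw
    · exact absurd (huw ▸ S.sub w (hJW w hw).1) (S.disj u hu)
    · exact absurd (huw ▸ S.sub u (hJW u hu).1) (S.disj w hw)
    · exact hJi hu hw huw
  · intro u hu
    rcases Finset.mem_union.1 hu with hu | hu
    · exact fun h => S.disj u hu (Finset.mem_sdiff.1 h).1
    · exact fun h => (Finset.mem_sdiff.1 h).2 (Finset.mem_image_of_mem σ hu)
  · rw [Finset.card_union_of_disjoint hIJ, hcs]
    have := S.card
    omega
  · intro w hw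
    exact Finset.mem_sdiff.2 ⟨S.sub w hw.1, hw.2.2⟩
  · intro u hu w hw huw
    rcases Finset.mem_union.1 hu with hu | hu
    · exact S.sep u hu w hw.1 huw
    · exact hw.2.1 (hball2 u w (hJW u hu).2.1 huw)
  · intro n hn
    have c1 := colSet_ball h2 v
    have c2 : ColSet G {w | σ w ∈ D} D.card :=
      colSet_of_values D σ (fun w hw => hw) (fun u _ w _ huw => hσ huw)
    have c3 : ColSet G W (n + (s₂ + D.card)) := by
      refine hn.union (c1.union c2 (le_refl _)) ?_
      intro w hw
      by_cases q1 : w ∈ ballSet G v 2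
      · exact Or.inr (Or.inl q1)
      · by_cases q2 : σ w ∈ D
        · exact Or.inr (Or.inr q2)
        · exact Or.inl ⟨hw, q1, q2⟩
    have := S.chi _ c3
    omega
  · rw [hcs, Nat.mul_sub, hDc, hJc]
    have : s₁ * T'.card ≤ s₁ * C.card := Nat.mul_le_mul_left _ (by omega)
    omega

lemma GState.start {V : Type*} [Fintype V] {G : SimpleGraph V} {σ : V → ℕ} {k : ℕ}
    (hp : (σ '' Set.univ).ncard = chromNum G + k) :
    GState G σ (chromNum G + k) k ∅ Set.univ (Finset.univ.image σ) := by
  classical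
  have hc : (Finset.univ.image σ).card = chromNum G + k := by
    rw [← hp, ← Set.ncard_coe_finset]; simp
  refine ⟨by simp, by simp, by simp, by simpa using hc, by simp, by simp, ?_⟩
  intro n hn
  rw [hc]
  have := chromNum_le_of_colSet hn
  omega

lemma GState.real_step {s c c' K : ℕ} (hs : 2 ≤ s) (h : c / (K + 1) + s * c' ≤ s * c) :
    (c' : ℝ) ≤ c * (1 - 1 / (s * (K + 1 : ℝ))) + 1 / 2 := by
  have hs' : (2 : ℝ) ≤ s := by exact_mod_cast hs
  have h' : ((c / (K + 1) : ℕ) : ℝ) + s * c' ≤ s * c := by exact_mod_cast h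
  have hlt : c < (c / (K + 1) + 1) * (K + 1) := by
    have := Nat.lt_div_mul_add (a := c) (b := K + 1) (by omega)
    linarith
  have hlt' : (c : ℝ) < (((c / (K + 1) : ℕ) : ℝ) + 1) * (K + 1) := by exact_mod_cast hlt
  have hK : (0 : ℝ) < K + 1 := by positivity
  have hd : (c : ℝ) / (K + 1) - 1 ≤ ((c / (K + 1) : ℕ) : ℝ) := by
    rw [← div_lt_iff₀ hK] at hlt'
    linarith
  have h3 : (s : ℝ) * c' ≤ s * (c * (1 - 1 / (s * (K + 1 : ℝ))) + 1 / 2) := by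
    have : (s : ℝ) * (c * (1 - 1 / (s * (K + 1 : ℝ))) + 1 / 2) = s * c - c / (K + 1) + s / 2 := by
      field_simp
    rw [this]
    linarith
  exact le_of_mul_le_mul_left h3 (by linarith)

/-- one factor of the decay estimate -/
lemma factor_bound {s₁ s₂ y : ℝ} (h1 : 2 ≤ s₁) (h2 : 2 ≤ s₂) (hy : 1 ≤ y) :
    1 - 1 / (s₁ * y) ≤ (y / (y + s₂)) ^ (1 / (s₁ * s₂)) := by
  have hy0 : 0 < y := by linarith
  have hq : 0 < y / (y + s₂) := by positivity
  rw [Real.rpow_def_of_pos hq]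
  refine le_trans ?_ (Real.add_one_le_exp _)
  have hl : 1 - (y / (y + s₂))⁻¹ ≤ Real.log (y / (y + s₂)) := Real.one_sub_inv_le_log_of_pos hq
  have e : 1 - (y / (y + s₂))⁻¹ = - (s₂ / y) := by field_simp; ring
  rw [e] at hl
  have := mul_le_mul_of_nonneg_right hl (show 0 ≤ 1 / (s₁ * s₂) by positivity)
  have e2 : -(s₂ / y) * (1 / (s₁ * s₂)) = - (1 / (s₁ * y)) := by field_simp
  rw [e2] at this
  linarith

lemma GState.iter {V : Type*} [Fintype V] {G : SimpleGraph V} {σ : V → ℕ} {k : ℕ}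
    (hp : (σ '' Set.univ).ncard = chromNum G + k)
    (hσ : IsProperColoring G σ) {s₁ s₂ : ℕ} (hs₁ : 2 ≤ s₁) (hs₂ : 2 ≤ s₂)
    (h1 : RLocallyColorable G 1 s₁) (h2 : RLocallyColorable G 2 s₂) (t : ℕ) :
    ∃ I W C, GState G σ (chromNum G + k) (k + t * s₂) I W C ∧
      (C.card : ℝ) ≤ ((chromNum G + k : ℕ) : ℝ) *
        ((k + 1 : ℝ) / (k + 1 + t * s₂)) ^ (1 / ((s₁ : ℝ) * s₂)) + t / 2 := by
  induction t with
  | zero =>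
    refine ⟨_, _, _, by simpa using GState.start hp, ?_⟩
    have := (GState.start hp).card
    simp only [Finset.card_empty, zero_add] at this
    rw [this]
    have : (k : ℝ) + 1 ≠ 0 := by positivity
    simp [this]
  | succ t ih =>
    obtain ⟨I, W, C, S, hb⟩ := ih
    obtain ⟨I', W', C', S', hc⟩ := S.step hσ h1 h2
    refine ⟨I', W', C', ?_, ?_⟩
    · convert S' using 1
      ring
    have hr := GState.real_step hs₁ hc
    have a1 : (2 : ℝ) ≤ s₁ := by exact_mod_cast hs₁
    have a2 : (2 : ℝ) ≤ s₂ := by exact_mod_cast hs₂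
    set y : ℝ := k + 1 + t * s₂ with hy
    have hy1 : 1 ≤ y := by
      have : (0 : ℝ) ≤ k := by positivity
      have : (0 : ℝ) ≤ t * s₂ := by positivity
      linarith
    have hf := factor_bound a1 a2 hy1
    have hKy : (((k + t * s₂ : ℕ) : ℝ) + 1) = y := by push_cast; rw [hy]; ring
    rw [hKy] at hr
    have hf0 : 0 ≤ 1 - 1 / (s₁ * y) := by
      have : 1 / (s₁ * y) ≤ 1 := by
        rw [div_le_one (by positivity)]; nlinarith
      linarith
    have hf1 : 1 - 1 / (s₁ * y) ≤ 1 := by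
      have : 0 ≤ 1 / (s₁ * y) := by positivity
      linarith
    have hprod : ((k + 1 : ℝ) / (k + 1 + ((t + 1 : ℕ) : ℝ) * s₂)) ^ (1 / ((s₁ : ℝ) * s₂))
        = ((k + 1 : ℝ) / y) ^ (1 / ((s₁ : ℝ) * s₂)) * (y / (y + s₂)) ^ (1 / ((s₁ : ℝ) * s₂)) := by
      rw [← Real.mul_rpow (by positivity) (by positivity)]
      congr 1
      have : (k + 1 + ((t + 1 : ℕ) : ℝ) * s₂) = y + s₂ := by push_cast; rw [hy]; ring
      rw [this]
      field_simp
    rw [hprod]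
    set P : ℝ := ((chromNum G + k : ℕ) : ℝ) * ((k + 1 : ℝ) / y) ^ (1 / ((s₁ : ℝ) * s₂)) with hP
    have hP0 : 0 ≤ P := by positivity
    calc (C'.card : ℝ) ≤ C.card * (1 - 1 / (s₁ * y)) + 1 / 2 := hr
      _ ≤ (P + t / 2) * (1 - 1 / (s₁ * y)) + 1 / 2 := by gcongr
      _ = P * (1 - 1 / (s₁ * y)) + t / 2 * (1 - 1 / (s₁ * y)) + 1 / 2 := by ring
      _ ≤ P * (y / (y + s₂)) ^ (1 / ((s₁ : ℝ) * s₂)) + t / 2 * 1 + 1 / 2 := by gcongr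
      _ = _ := by rw [hP]; push_cast; ring

/-- For all integers `s₁, s₂ ≥ 2`: if `G` is finite, nonempty, `1`-locally
`s₁`-colourable and `2`-locally `s₂`-colourable, `p = χ(G)+k`, and `σ` is a proper
colouring of `G` using exactly `p` colours, then `G` has a `σ`-rainbow independent set
of size at least `p - p^{1-1/(3s₁s₂)} - ((k+1)/s₂)·p^{1/3}`. -/
theorem rainbow_independent_set {V : Type*} [Fintype V] [Nonempty V]
    (s₁ s₂ : ℕ) (hs₁ : 2 ≤ s₁) (hs₂ : 2 ≤ s₂) (G : SimpleGraph V)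
    (h1 : RLocallyColorable G 1 s₁) (h2 : RLocallyColorable G 2 s₂)
    (k : ℕ) (σ : V → ℕ) (hσ : IsProperColoring G σ)
    (hp : (σ '' Set.univ).ncard = chromNum G + k) :
    ∃ I : Finset V, (∀ u ∈ I, ∀ v ∈ I, ¬ G.Adj u v) ∧ Set.InjOn σ (↑I : Set V) ∧
      (I.card : ℝ) ≥ ((chromNum G + k : ℕ) : ℝ)
        - ((chromNum G + k : ℕ) : ℝ) ^ (1 - 1 / (3 * (s₁ : ℝ) * (s₂ : ℝ)))
        - (((k : ℝ) + 1) / (s₂ : ℝ)) * ((chromNum G + k : ℕ) : ℝ) ^ ((1 : ℝ) / 3) := by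
  obtain ⟨v0⟩ := ‹Nonempty V›
  have hchi : 1 ≤ chromNum G := by
    by_contra h
    have h0 : chromNum G = 0 := by omega
    obtain ⟨c⟩ := colorable_chromNum G
    have := (c v0).isLt
    omega
  have a1 : (2 : ℝ) ≤ s₁ := by exact_mod_cast hs₁
  have a2 : (2 : ℝ) ≤ s₂ := by exact_mod_cast hs₂
  have hkp : k + 1 ≤ chromNum G + k := by omega
  have hstart := GState.start hp
  have hiter := GState.iter hp hσ hs₁ hs₂ h1 h2
  generalize chromNum G + k = p at *
  have hkp' : (k : ℝ) + 1 ≤ p := by exact_mod_cast hkp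
  have hk0 : (0 : ℝ) ≤ k := by positivity
  have hp1 : (1 : ℝ) ≤ p := by linarith
  have hp0 : (0 : ℝ) < p := by linarith
  set x : ℝ := (p : ℝ) ^ ((1 : ℝ) / 3) with hx
  have hx1 : 1 ≤ x := Real.one_le_rpow hp1 (by norm_num)
  have hx3 : x ^ 3 = p := by
    rw [hx, ← Real.rpow_natCast, ← Real.rpow_mul hp0.le]; norm_num
  set T : ℝ := ((k : ℝ) + 1) / s₂ with hT
  have hT0 : 0 < T := by positivity
  have hTs : T * s₂ = k + 1 := by rw [hT]; field_simp
  by_cases hbig : 1 ≤ T * (x + 1)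
  · -- many steps
    set t := ⌈T * (x - 1)⌉₊ with ht
    have ht1 : T * (x - 1) ≤ t := Nat.le_ceil _
    have ht2 : (t : ℝ) < T * (x - 1) + 1 :=
      Nat.ceil_lt_add_one (mul_nonneg hT0.le (by linarith))
    obtain ⟨I, W, C, S, hb⟩ := hiter t
    refine ⟨I, S.indep, S.inj, ?_⟩
    have hc : (I.card : ℝ) + C.card = p := by exact_mod_cast S.card
    have hratio : ((k : ℝ) + 1) / (k + 1 + t * s₂) ≤ x⁻¹ := by
      rw [inv_eq_one_div, div_le_div_iff₀ (by positivity) (by linarith)]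
      have := mul_le_mul_of_nonneg_right ht1 (show (0 : ℝ) ≤ s₂ by linarith)
      have e : T * (x - 1) * s₂ = (k + 1) * (x - 1) := by rw [← hTs]; ring
      rw [e] at this
      linarith
    have hpow : (x⁻¹) ^ (1 / ((s₁ : ℝ) * s₂)) * p = (p : ℝ) ^ (1 - 1 / (3 * (s₁ : ℝ) * (s₂ : ℝ))) := by
      rw [Real.inv_rpow (by linarith), ← Real.rpow_neg (by linarith), hx,
        ← Real.rpow_mul hp0.le]
      nth_rewrite 2 [← Real.rpow_one (p : ℝ)]
      rw [← Real.rpow_add hp0]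
      congr 1
      field_simp
      ring
    have hmono : ((k + 1 : ℝ) / (k + 1 + t * s₂)) ^ (1 / ((s₁ : ℝ) * s₂)) ≤
        (x⁻¹) ^ (1 / ((s₁ : ℝ) * s₂)) :=
      Real.rpow_le_rpow (by positivity) hratio (by positivity)
    have := mul_le_mul_of_nonneg_right hmono hp0.le
    rw [hpow] at this
    have : T * x ≥ t / 2 := by nlinarith
    linarith
  · -- a single step
    push Not at hbig
    obtain ⟨I, W, C, S, hb⟩ := hstart.step hσ h1 h2
    have hcc := hstart.card
    simp only [Finset.card_empty, zero_add] at hcc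
    rw [hcc] at hb
    refine ⟨I, S.indep, S.inj, ?_⟩
    have hc : I.card + C.card = p := S.card
    have hI : p / (k + 1) ≤ s₁ * I.card := by
      have : s₁ * p = s₁ * I.card + s₁ * C.card := by rw [← hc]; ring
      omega
    have hhalf : p ≤ 2 * (p / (k + 1)) * (k + 1) := by
      have q1 : 1 ≤ p / (k + 1) := (Nat.one_le_div_iff (by omega)).2 hkp
      have q2 := Nat.lt_div_mul_add (a := p) (b := k + 1) (by omega)
      nlinarith
    have hfin : p ≤ 2 * (s₁ * I.card) * (k + 1) :=
      hhalf.trans (by gcongr)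
    have hfin' : (p : ℝ) ≤ 2 * (s₁ * I.card) * (k + 1) := by exact_mod_cast hfin
    -- analytic part
    have hsmall : (k + 1 : ℝ) * (x + 1) ≤ s₂ := by
      have := mul_le_mul_of_nonneg_right hbig.le (show (0 : ℝ) ≤ s₂ by linarith)
      have e : T * (x + 1) * s₂ = (k + 1) * (x + 1) := by rw [← hTs]; ring
      linarith
    have hlogp : Real.log p = 3 * Real.log x := by
      rw [← hx3, Real.log_pow]; norm_num
    have hlx : 2 * Real.log x ≤ x + 1 := by
      have hq := Real.log_le_sub_one_of_pos (show (0 : ℝ) < x / 2 by linarith)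
      rw [Real.log_div (by linarith) (by norm_num)] at hq
      have := Real.log_two_lt_d9
      have hq' := Real.log_le_sub_one_of_pos (show (0 : ℝ) < x / 2 by linarith)
      linarith
    have hpw : (p : ℝ) - (p : ℝ) * (Real.log x / (s₁ * s₂)) ≤
        (p : ℝ) ^ (1 - 1 / (3 * (s₁ : ℝ) * (s₂ : ℝ))) := by
      rw [sub_eq_add_neg 1, Real.rpow_add hp0, Real.rpow_one,
        Real.rpow_def_of_pos hp0, hlogp]
      have := Real.add_one_le_exp (3 * Real.log x * -(1 / (3 * (s₁ : ℝ) * s₂)))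
      have e : 3 * Real.log x * -(1 / (3 * (s₁ : ℝ) * s₂)) = - (Real.log x / (s₁ * s₂)) := by
        field_simp
      rw [e] at this ⊢
      nlinarith
    have hmain : (p : ℝ) * (Real.log x / (s₁ * s₂)) ≤ I.card := by
      rw [mul_div_assoc', div_le_iff₀ (by positivity)]
      have hI0 : (0 : ℝ) ≤ I.card := by positivity
      have hl0 : 0 ≤ Real.log x := Real.log_nonneg hx1
      have hA : (0 : ℝ) ≤ s₁ * I.card := by positivity
      calc (p : ℝ) * Real.log x ≤ 2 * (s₁ * I.card) * (k + 1) * Real.log x := by gcongr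
        _ = (s₁ * I.card) * ((k + 1) * (2 * Real.log x)) := by ring
        _ ≤ (s₁ * I.card) * ((k + 1) * (x + 1)) := by gcongr
        _ ≤ (s₁ * I.card) * s₂ := by gcongr
        _ = _ := by ring
    have : 0 ≤ T * x := by positivity
    linarith
end

section
/- Let ℓ ≥ 2 and k ≥ 0 be integers. Every finite C_{ℓ+1}-free simple graph G with at least one vertex (and with χ(G)+k ≤ |V(G)|) satisfies f_G(χ(G) + k) ≤ (ℓ−1)(k+1) + 1. -/
open SimpleGraph

open Classical in
/-- A "first-fit" colouring of a set of vertices. -/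
lemma exists_greedy {V : Type*} [Fintype V] (G : SimpleGraph V) (N : Set V) :
    ∃ c : V → ℕ, (∀ u ∈ N, ∀ v ∈ N, G.Adj u v → c u ≠ c v) ∧
      ∀ v ∈ N, ∀ i < c v, ∃ u ∈ N, G.Adj v u ∧ c u = i := by
  have hex : ∃ s : ℕ, ∃ c : V → ℕ, (∀ u ∈ N, ∀ v ∈ N, G.Adj u v → c u ≠ c v) ∧
      ∑ v, c v = s := by
    refine ⟨_, fun v => (Fintype.equivFin V v : ℕ), ?_, rfl⟩
    intro u _ v _ h e
    have : u = v := (Fintype.equivFin V).injective (Fin.ext e)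
    exact h.ne this
  obtain ⟨c, hc, hs⟩ := Nat.find_spec hex
  refine ⟨c, hc, ?_⟩
  intro v hv i hi
  by_contra hno
  push Not at hno
  have hlt : ∑ w, Function.update c v i w < Nat.find hex := by
    rw [← hs]
    apply Finset.sum_lt_sum
    · intro w _
      by_cases h : w = v
      · subst h; simp; omega
      · simp [h]
    · exact ⟨v, Finset.mem_univ _, by simpa using hi⟩
  refine Nat.find_min hex hlt ⟨_, ?_, rfl⟩
  intro u hu w hw huw
  by_cases h1 : u = v
  · subst h1
    have h2 : w ≠ u := huw.ne'
    simp only [Function.update_self, Function.update_of_ne h2]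
    exact (hno w hw huw).symm
  · by_cases h2 : w = v
    · subst h2
      simp only [Function.update_self, Function.update_of_ne h1]
      exact hno u hu huw.symm
    · simp only [Function.update_of_ne h1, Function.update_of_ne h2]
      exact hc u hu w hw huw

lemma greedy_path {V : Type*} (G : SimpleGraph V) (N : Set V) (c : V → ℕ)
    (hc : ∀ v ∈ N, ∀ i < c v, ∃ u ∈ N, G.Adj v u ∧ c u = i) :
    ∀ (i : ℕ) (v : V), v ∈ N → i ≤ c v → ∃ (w : V) (p : G.Walk v w), p.IsPath ∧ p.length = i ∧
      ∀ u ∈ p.support, u ∈ N ∧ c u ≤ c v := by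
  intro i
  induction i with
  | zero =>
    intro v hv _
    exact ⟨v, SimpleGraph.Walk.nil, by simp, by simp, by simpa using hv⟩
  | succ i ih =>
    intro v hv hi
    obtain ⟨u, hu, hvu, hcu⟩ := hc v hv (c v - 1) (by omega)
    obtain ⟨w, p, hp, hl, hs⟩ := ih u hu (by omega)
    refine ⟨w, SimpleGraph.Walk.cons hvu p, ?_, by simp [hl], ?_⟩
    · rw [SimpleGraph.Walk.cons_isPath_iff]
      refine ⟨hp, fun h => ?_⟩
      have := (hs v h).2
      omega
    · intro a ha
      rw [SimpleGraph.Walk.support_cons, List.mem_cons] at ha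
      rcases ha with rfl | ha
      · exact ⟨hv, le_rfl⟩
      · have := hs a ha
        exact ⟨this.1, by omega⟩

lemma nbhd_coloring {V : Type*} [Fintype V] (ℓ : ℕ) (hℓ : 2 ≤ ℓ) (G : SimpleGraph V)
    (hc : CycleLenFree G (ℓ + 1)) (x : V) :
    ∃ c : V → Fin (ℓ - 1), ∀ u v, G.Adj x u → G.Adj x v → G.Adj u v → c u ≠ c v := by
  obtain ⟨c, h1, h2⟩ := exists_greedy G (G.neighborSet x)
  have hlt : ∀ v, G.Adj x v → c v < ℓ - 1 := by
    intro v hv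
    by_contra hge
    obtain ⟨w, p, hp, hl, hs⟩ := greedy_path G _ c h2 (ℓ - 1) v hv (by omega)
    have hxs : x ∉ p.support := fun h => G.loopless.irrefl x (hs x h).1
    have hw : G.Adj w x := ((hs w p.end_mem_support).1 : G.Adj x w).symm
    have hvw : v ≠ w := by
      rintro rfl
      rw [SimpleGraph.Walk.isPath_iff_eq_nil] at hp
      subst hp
      simp at hl
      omega
    refine hc x (SimpleGraph.Walk.cons hv (p.concat hw)) ?_ ?_
    · rw [SimpleGraph.Walk.cons_isCycle_iff]
      refine ⟨hp.concat hxs hw, ?_⟩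
      rw [SimpleGraph.Walk.edges_concat, List.concat_eq_append, List.mem_append]
      rintro (h | h)
      · exact hxs (p.fst_mem_support_of_mem_edges h)
      · simp only [List.mem_singleton, Sym2.eq_iff] at h
        rcases h with ⟨rfl, rfl⟩ | ⟨_, rfl⟩
        · exact hw.ne rfl
        · exact hvw rfl
    · simp [hl]; omega
  classical
  refine ⟨fun v => if h : G.Adj x v then ⟨c v, hlt v h⟩ else ⟨0, by omega⟩, ?_⟩
  intro u v hu hv huv
  simp only [hu, hv, dif_pos]
  intro h
  exact h1 u hu v hv huv (by simpa using h)

open Classical in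
/-- If no `n` vertices dominate all colours then `n` colours can be saved. -/
lemma save_colors {V : Type*} [Fintype V] (G : SimpleGraph V) (σ : V → ℕ)
    (hσ : IsProperColoring G σ) : ∀ (n : ℕ) (P : Finset ℕ), (∀ j ∈ P, ∃ v, σ v = j) →
    (∀ X : Finset V, X.card ≤ n → ∃ j ∈ P, ∀ x ∈ X, σ x ≠ j ∧ ∀ u, G.Adj x u → σ u ≠ j) →
    ∃ (c : V → ℕ) (Q : Finset ℕ), Q ⊆ P ∧ Q.card + n ≤ P.card ∧ (∀ v, σ v ∈ P → c v ∈ Q) ∧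
      ∀ u v, σ u ∈ P → σ v ∈ P → G.Adj u v → c u ≠ c v := by
  intro n
  induction n with
  | zero =>
    intro P _ _
    exact ⟨σ, P, subset_rfl, by simp, fun v h => h, fun u v _ _ h => hσ h⟩
  | succ n ih =>
    intro P hP hX
    let M : V → Finset ℕ := fun x => P.filter fun j => σ x ≠ j ∧ ∀ u, G.Adj x u → σ u ≠ j
    have hM : ∀ x j, j ∈ M x ↔ j ∈ P ∧ σ x ≠ j ∧ ∀ u, G.Adj x u → σ u ≠ j := by
      intro x j; simp [M]
    have hne : (Finset.univ.filter fun x => σ x ∈ P).Nonempty := by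
      obtain ⟨j, hj, _⟩ := hX ∅ (by simp)
      obtain ⟨v, rfl⟩ := hP j hj
      exact ⟨v, by simpa using hj⟩
    obtain ⟨x, hx, hmin⟩ := Finset.exists_min_image _ (fun x => (M x).card) hne
    have hxP : σ x ∈ P := by simpa using hx
    have hCP : M x ⊆ P := Finset.filter_subset _ _
    obtain ⟨c, Q, hQC, hQn, hcQ, hcp⟩ := ih (M x) (fun j hj => hP j (hCP hj)) (by
      intro X hXn
      obtain ⟨j, hj, h⟩ := hX (insert x X) ((Finset.card_insert_le _ _).trans (by omega))
      refine ⟨j, ?_, fun y hy => h y (Finset.mem_insert_of_mem hy)⟩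
      rw [hM]
      exact ⟨hj, h x (Finset.mem_insert_self _ _)⟩)
    have hq : Q.Nonempty := by
      obtain ⟨j, hj, h⟩ := hX {x} (by simp)
      obtain ⟨v, rfl⟩ := hP j hj
      exact ⟨c v, hcQ v ((hM _ _).2 ⟨hj, h x (by simp)⟩)⟩
    obtain ⟨q, hq⟩ := hq
    have hxC : σ x ∉ M x := by rw [hM]; simp
    have hkey : ∀ v, σ v ∈ P → (¬ ∃ j, j ∈ M v ∧ j ∉ M x) → M v = M x := by
      intro v hv h
      push Not at h
      exact Finset.eq_of_subset_of_card_le h (hmin v (by simpa using hv))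
    let c' : V → ℕ := fun v => if σ v ∈ M x then c v else if σ v = σ x then
      (if h : ∃ j, j ∈ M v ∧ j ∉ M x then h.choose else q) else σ v
    have c1 : ∀ v, σ v ∈ M x → c' v = c v := fun v h => by simp [c', h]
    have c2 : ∀ v, σ v ∉ M x → σ v ≠ σ x → c' v = σ v := fun v h h' => by simp [c', h, h']
    have c3 : ∀ v, σ v = σ x → (c' v ∈ M v ∧ c' v ∉ M x) ∨ (c' v = q ∧ (σ v ∈ P → M v = M x)) := by
      intro v h
      have h0 : σ v ∉ M x := h ▸ hxC
      by_cases h' : ∃ j, j ∈ M v ∧ j ∉ M x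
      · left
        have : c' v = h'.choose := by simp only [c', if_neg h0, if_pos h, dif_pos h']
        rw [this]
        exact h'.choose_spec
      · right
        exact ⟨by simp only [c', if_neg h0, if_pos h, dif_neg h'], fun hv => hkey v hv h'⟩
    have main : ∀ u v, σ u ∈ P → σ v ∈ P → G.Adj u v → σ u = σ x → c' u ≠ c' v := by
      intro u v hu hv huv hux
      have hvx : σ v ≠ σ x := fun h => hσ huv (hux.trans h.symm)
      rcases c3 u hux with ⟨ha, hb⟩ | ⟨ha, hb⟩
      · by_cases hvC : σ v ∈ M x
        · rw [c1 v hvC]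
          intro h
          exact hb (h ▸ hQC (hcQ v hvC))
        · rw [c2 v hvC hvx]
          intro h
          exact ((hM _ _).1 ha).2.2 v huv h.symm
      · have hvC : σ v ∉ M x := by
          rw [← hb hu, hM]
          intro h
          exact h.2.2 v huv rfl
        rw [ha, c2 v hvC hvx]
        intro h
        exact hvC (h ▸ hQC hq)
    refine ⟨c', Q ∪ (P \ M x).erase (σ x), ?_, ?_, ?_, ?_⟩
    · intro j hj
      simp only [Finset.mem_union, Finset.mem_erase, Finset.mem_sdiff] at hj
      rcases hj with h | h
      · exact hCP (hQC h)
      · exact h.2.1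
    · have e1 := Finset.card_union_le Q ((P \ M x).erase (σ x))
      have e2 : σ x ∈ P \ M x := Finset.mem_sdiff.2 ⟨hxP, hxC⟩
      have e3 := Finset.card_erase_add_one e2
      have e4 := Finset.card_sdiff_add_card_eq_card hCP
      omega
    · intro v hv
      simp only [Finset.mem_union, Finset.mem_erase, Finset.mem_sdiff]
      by_cases h1 : σ v ∈ M x
      · left; rw [c1 v h1]; exact hcQ v h1
      · by_cases h2 : σ v = σ x
        · rcases c3 v h2 with ⟨ha, hb⟩ | ⟨ha, hb⟩
          · right
            have := (hM _ _).1 ha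
            exact ⟨fun h => this.2.1 (h2.trans h.symm), this.1, hb⟩
          · left; rw [ha]; exact hq
        · right; rw [c2 v h1 h2]; exact ⟨h2, hv, h1⟩
    · intro u v hu hv huv
      by_cases hux : σ u = σ x
      · exact main u v hu hv huv hux
      by_cases hvx : σ v = σ x
      · exact (main v u hv hu huv.symm hvx).symm
      by_cases huC : σ u ∈ M x
      · by_cases hvC : σ v ∈ M x
        · rw [c1 u huC, c1 v hvC]; exact hcp u v huC hvC huv
        · rw [c1 u huC, c2 v hvC hvx]
          intro h
          exact hvC (h ▸ hQC (hcQ u huC))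
      · by_cases hvC : σ v ∈ M x
        · rw [c2 u huC hux, c1 v hvC]
          intro h
          exact huC (h ▸ hQC (hcQ v hvC))
        · rw [c2 u huC hux, c2 v hvC hvx]; exact hσ huv

open Classical in
lemma closedNbhd_chrom {V : Type*} [Fintype V] (ℓ : ℕ) (hℓ : 2 ≤ ℓ) (G : SimpleGraph V)
    (hc : CycleLenFree G (ℓ + 1)) (X : Finset V) :
    chromNum (G.induce (closedNbhd G (X : Set V))) ≤ (ℓ - 1) * X.card + 1 := by
  choose c h using nbhd_coloring ℓ hℓ G hc
  let f : V → Option (X × Fin (ℓ - 1)) := fun v =>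
    if hv : ∃ x : X, G.Adj x v then some (hv.choose, c hv.choose v) else none
  have hf : ∀ u v, u ∈ closedNbhd G (X : Set V) → v ∈ closedNbhd G (X : Set V) →
      G.Adj u v → f u ≠ f v := by
    intro u v hu hv huv
    by_cases h1 : ∃ x : X, G.Adj x u
    · by_cases h2 : ∃ x : X, G.Adj x v
      · simp only [f, dif_pos h1, dif_pos h2]
        intro e
        simp only [Option.some.injEq, Prod.mk.injEq] at e
        have hs1 := h1.choose_spec
        have hs2 := h2.choose_spec
        rw [← e.1] at hs2
        refine h _ u v hs1 hs2 huv ?_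
        rw [e.2, ← e.1]
      · simp only [f, dif_pos h1, dif_neg h2]; exact Option.some_ne_none _
    · by_cases h2 : ∃ x : X, G.Adj x v
      · simp only [f, dif_neg h1, dif_pos h2]; exact (Option.some_ne_none _).symm
      · exfalso
        rcases hu with hu | ⟨x, hx, hxu⟩
        · exact h2 ⟨⟨u, hu⟩, huv⟩
        · exact h1 ⟨⟨x, hx⟩, hxu⟩
  let C : (G.induce (closedNbhd G (X : Set V))).Coloring (Option (X × Fin (ℓ - 1))) :=
    SimpleGraph.Coloring.mk (fun v => f v) (fun {u v} huv => hf u v u.2 v.2 huv)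
  have hcol := C.colorable
  simp only [Fintype.card_option, Fintype.card_prod, Fintype.card_coe, Fintype.card_fin] at hcol
  rw [mul_comm]
  exact Nat.sInf_le hcol

/-- For integers `ℓ ≥ 2` and `k ≥ 0`, every finite `C_{ℓ+1}`-free graph
`G` with at least one vertex (and `χ(G)+k ≤ |V(G)|`) satisfies
`f_G(χ(G)+k) ≤ (ℓ-1)(k+1)+1`. -/
theorem fG_cycleFree {V : Type*} [Fintype V] [Nonempty V]
    (ℓ k : ℕ) (hℓ : 2 ≤ ℓ) (G : SimpleGraph V) (hc : CycleLenFree G (ℓ + 1))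
    (hpk : chromNum G + k ≤ Fintype.card V) :
    fG G (chromNum G + k) ≤ (ℓ - 1) * (k + 1) + 1 := by
  classical
  apply csSup_le'
  rintro m ⟨σ, hσ, hp, rfl⟩
  have hP : (Finset.univ.image σ).card = chromNum G + k := by
    rw [← hp, ← Set.ncard_coe_finset]; simp
  have hex : ∃ X : Finset V, X.card ≤ k + 1 ∧ ∀ v, ∃ u ∈ closedNbhd G (X : Set V), σ u = σ v := by
    by_contra hno
    push Not at hno
    obtain ⟨c, Q, -, hQ, hcQ, hcp⟩ := save_colors G σ hσ (k + 1) (Finset.univ.image σ)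
      (by simp) (by
        intro X hX
        obtain ⟨v, hv⟩ := hno X hX
        refine ⟨σ v, by simp, fun x hx => ⟨hv x (Or.inl hx), fun u hu => hv u (Or.inr ⟨x, hx, hu⟩)⟩⟩)
    let C : G.Coloring Q := SimpleGraph.Coloring.mk (fun v => ⟨c v, hcQ v (by simp)⟩) (by
      intro u v huv h
      exact hcp u v (by simp) (by simp) huv (by simpa using h))
    have hcol := C.colorable
    rw [Fintype.card_coe] at hcol
    have : chromNum G ≤ Q.card := Nat.sInf_le hcol
    omega
  obtain ⟨X, hX, hdom⟩ := hex
  have himg : σ '' closedNbhd G (X : Set V) = σ '' Set.univ := by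
    apply Set.Subset.antisymm (Set.image_mono (Set.subset_univ _))
    rintro _ ⟨v, _, rfl⟩
    obtain ⟨u, hu, e⟩ := hdom v
    exact ⟨u, hu, e⟩
  have h1 : minRainbowChrom G σ (chromNum G + k) ≤
      chromNum (G.induce (closedNbhd G (X : Set V))) :=
    Nat.sInf_le ⟨_, by rw [himg, hp], rfl⟩
  have h2 := closedNbhd_chrom ℓ hℓ G hc X
  have h3 : (ℓ - 1) * X.card ≤ (ℓ - 1) * (k + 1) := Nat.mul_le_mul_left _ hX
  omega
end

section
/- Let ℓ ≥ 2 be an integer, let G be a finite C_{ℓ+1}-free simple graph, and set t := ⌊ℓ/2⌋. Then for every vertex v of G, the ball B_t(v), i.e. the subgraph of G induced by the vertices at distance at most t from v, satisfies χ(B_t(v)) ≤ 2ℓ. -/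
open SimpleGraph

lemma seq_path {V : Type*} (G : SimpleGraph V) (y : ℕ → V) (m : ℕ)
    (hadj : ∀ s < m, G.Adj (y s) (y (s + 1)))
    (hinj : ∀ s ≤ m, ∀ s' ≤ m, y s = y s' → s = s') :
    ∃ w : G.Walk (y 0) (y m), w.IsPath ∧ w.length = m ∧ ∀ z ∈ w.support, ∃ s ≤ m, z = y s := by
  induction m with
  | zero => exact ⟨Walk.nil, by simp, rfl, by simp⟩
  | succ m ih =>
    obtain ⟨w, hw, hl, hs⟩ := ih (fun s h => hadj s (by omega))
      (fun s h s' h' => hinj s (by omega) s' (by omega))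
    refine ⟨w.concat (hadj m (by omega)), hw.concat ?_ _, by simp [hl], ?_⟩
    · intro hmem
      obtain ⟨s, h1, h2⟩ := hs _ hmem
      have := hinj _ le_rfl s (by omega) h2
      omega
    · intro z hz
      rw [Walk.support_concat] at hz
      simp only [List.concat_eq_append, List.mem_append, List.mem_singleton] at hz
      rcases hz with hz | hz
      · obtain ⟨s, h1, h2⟩ := hs _ hz
        exact ⟨s, by omega, h2⟩
      · exact ⟨m + 1, le_rfl, hz⟩

lemma seq_cycle {V : Type*} (G : SimpleGraph V) (y : ℕ → V) (m : ℕ) (hm : 2 ≤ m)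
    (hadj : ∀ s < m, G.Adj (y s) (y (s + 1))) (hcl : G.Adj (y m) (y 0))
    (hinj : ∀ s ≤ m, ∀ s' ≤ m, y s = y s' → s = s') :
    ¬ CycleLenFree G (m + 1) := by
  intro hc
  obtain ⟨w, hw, hl, -⟩ := seq_path G y m hadj hinj
  refine hc _ (Walk.cons hcl w) ((Walk.cons_isCycle_iff _ _).2 ⟨hw, fun h => ?_⟩) (by simp [hl])
  rw [Sym2.eq_swap] at h
  have := hw.length_eq_one_of_mem_edges h
  omega

/-- Rank of a vertex at level `n` in a planar ordering of the tree with parent map `p`. -/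
def treeRank {V : Type*} (p : V → V) (e : V → ℕ) (N : ℕ) : ℕ → V → ℕ
  | 0, u => e u
  | k + 1, u => treeRank p e N k (p u) * N + e u

lemma treeRank_inj {V : Type*} (p : V → V) (e : V → ℕ) (N : ℕ) (he : ∀ u, e u < N)
    (hi : Function.Injective e) (n : ℕ) : Function.Injective (treeRank p e N n) := by
  intro u w h
  cases n with
  | zero => exact hi h
  | succ n =>
    simp only [treeRank] at h
    have := congrArg (· % N) h
    simp only [Nat.mul_add_mod_self_right, Nat.mod_eq_of_lt (he _)] at this
    exact hi this

lemma treeRank_div {V : Type*} (p : V → V) (e : V → ℕ) (N : ℕ) (he : ∀ u, e u < N)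
    (j : ℕ) : ∀ (k : ℕ) (u : V),
      treeRank p e N (k + j) u / N ^ j = treeRank p e N k (p^[j] u) := by
  induction j with
  | zero => intro k u; simp
  | succ j ih =>
    intro k u
    have hN : 0 < N := lt_of_le_of_lt (Nat.zero_le _) (he u)
    rw [Function.iterate_succ_apply, ← ih k (p u), ← add_assoc, pow_succ', ← Nat.div_div_eq_div_mul]
    congr 1
    simp only [treeRank]
    rw [Nat.mul_comm, Nat.mul_add_div hN, Nat.div_eq_of_lt (he u), add_zero]

lemma exists_order {V : Type*} [Fintype V] (p : V → V) (n : ℕ) :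
    ∃ r : V → ℕ, Function.Injective r ∧ ∀ j ≤ n, ∀ a b c, r a ≤ r b → r b ≤ r c →
      p^[j] a = p^[j] c → p^[j] b = p^[j] a := by
  classical
  let e : V → ℕ := fun u => (Fintype.equivFin V u : ℕ)
  have he : ∀ u, e u < Fintype.card V := fun u => (Fintype.equivFin V u).2
  have hi : Function.Injective e := fun a b h => (Fintype.equivFin V).injective (Fin.ext h)
  refine ⟨treeRank p e _ n, treeRank_inj p e _ he hi n, ?_⟩
  intro j hj a b c hab hbc hac
  obtain ⟨k, rfl⟩ : ∃ k, n = k + j := ⟨n - j, by omega⟩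
  apply treeRank_inj p e _ he hi k
  have h1 := Nat.div_le_div_right (c := Fintype.card V ^ j) hab
  have h2 := Nat.div_le_div_right (c := Fintype.card V ^ j) hbc
  rw [treeRank_div p e _ he, treeRank_div p e _ he] at h1 h2
  rw [← hac] at h2
  omega

/-- Vertices of the `n`-th distance layer from `v`. -/
def Lay {V : Type*} (G : SimpleGraph V) (v : V) (n : ℕ) (u : V) : Prop :=
  G.Reachable v u ∧ G.dist v u = n

lemma exists_parent {V : Type*} (G : SimpleGraph V) (v : V) :
    ∃ p : V → V, ∀ n u, Lay G v (n + 1) u → G.Adj u (p u) ∧ Lay G v n (p u) := by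
  have : ∀ u, ∃ q, ∀ n, Lay G v (n + 1) u → G.Adj u q ∧ Lay G v n q := by
    intro u
    by_cases h : ∃ n, Lay G v (n + 1) u
    · obtain ⟨n, hr, hd⟩ := h
      obtain ⟨w, hw⟩ := hr.symm.exists_walk_length_eq_dist
      rw [SimpleGraph.dist_comm, hd] at hw
      cases w with
      | nil => simp at hw
      | @cons _ q _ h w =>
        refine ⟨q, fun m hm => ⟨h, w.reverse.reachable, ?_⟩⟩
        have hm2 := hm.2
        have h1 := dist_le w.reverse
        simp at hw h1
        obtain ⟨w', hw'⟩ := w.reverse.reachable.exists_walk_length_eq_dist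
        have h2 := dist_le (w'.concat h.symm)
        simp at h2
        omega
    · push Not at h
      exact ⟨u, fun n hn => absurd hn (h n)⟩
  choose p hp using this
  exact ⟨p, fun n u => hp u n⟩

lemma no_chain {V : Type*} (ℓ : ℕ) (hℓ : 2 ≤ ℓ) (G : SimpleGraph V)
    (hc : CycleLenFree G (ℓ + 1)) (v : V) (p : V → V)
    (hp : ∀ n u, Lay G v (n + 1) u → G.Adj u (p u) ∧ Lay G v n (p u))
    (n : ℕ) (hn : n ≤ ℓ / 2) (r : V → ℕ)
    (hconv : ∀ j ≤ n, ∀ a b c, r a ≤ r b → r b ≤ r c → p^[j] a = p^[j] c → p^[j] b = p^[j] a)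
    (x : ℕ → V) (hL : ∀ a ≤ ℓ - 1, Lay G v n (x a))
    (hadj : ∀ a < ℓ - 1, G.Adj (x a) (x (a + 1))) (hr : ∀ a < ℓ - 1, r (x a) < r (x (a + 1))) :
    False := by
  classical
  have hmono : ∀ b ≤ ℓ - 1, ∀ a < b, r (x a) < r (x b) := by
    intro b
    induction b with
    | zero => intro _ a h; omega
    | succ b ih =>
      intro hb a ha
      have h1 := hr b (by omega)
      rcases Nat.lt_succ_iff_lt_or_eq.1 ha with h | h
      · exact (ih (by omega) a h).trans h1
      · rw [h]; exact h1
  have hmono' : ∀ b ≤ ℓ - 1, ∀ a ≤ b, r (x a) ≤ r (x b) := by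
    intro b hb a ha
    rcases ha.lt_or_eq with h | h
    · exact (hmono b hb a h).le
    · rw [h]
  have hxinj : ∀ a ≤ ℓ - 1, ∀ b ≤ ℓ - 1, x a = x b → a = b := by
    intro a ha b hb h
    rcases lt_trichotomy a b with h' | h' | h'
    · have := hmono b hb a h'; rw [h] at this; omega
    · exact h'
    · have := hmono a ha b h'; rw [h] at this; omega
  have hlev : ∀ i ≤ n, ∀ a ≤ ℓ - 1, Lay G v (n - i) (p^[i] (x a)) := by
    intro i
    induction i with
    | zero => intro _ a ha; exact hL a ha
    | succ i ih =>
      intro hi a ha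
      rw [Function.iterate_succ_apply']
      have := ih (by omega) a ha
      rw [show n - i = n - (i + 1) + 1 by omega] at this
      exact (hp _ _ this).2
  have hpadj : ∀ i < n, ∀ a ≤ ℓ - 1, G.Adj (p^[i] (x a)) (p^[i + 1] (x a)) := by
    intro i hi a ha
    rw [Function.iterate_succ_apply']
    have := hlev i hi.le a ha
    rw [show n - i = n - (i + 1) + 1 by omega] at this
    exact (hp _ _ this).1
  have hroot : ∀ a ≤ ℓ - 1, p^[n] (x a) = v := by
    intro a ha
    obtain ⟨h1, h2⟩ := hlev n le_rfl a ha
    rw [Nat.sub_self] at h2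
    exact ((h1.dist_eq_zero_iff).1 h2).symm
  have hex : ∃ j, p^[j] (x 0) = p^[j] (x (ℓ - 1)) :=
    ⟨n, by rw [hroot _ (by omega), hroot _ le_rfl]⟩
  obtain ⟨j, hj, hjmin⟩ : ∃ j, p^[j] (x 0) = p^[j] (x (ℓ - 1)) ∧
      ∀ i < j, p^[i] (x 0) ≠ p^[i] (x (ℓ - 1)) :=
    ⟨Nat.find hex, Nat.find_spec hex, fun i hi => Nat.find_min hex hi⟩
  have hjn : j ≤ n := by
    by_contra h
    exact hjmin n (by omega) (by rw [hroot _ (by omega), hroot _ le_rfl])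
  have hj1 : 1 ≤ j := by
    by_contra h
    have h0 : j = 0 := by omega
    subst h0
    have := hxinj 0 (by omega) (ℓ - 1) le_rfl hj
    omega
  have hall : ∀ a ≤ ℓ - 1, p^[j] (x a) = p^[j] (x 0) := fun a ha =>
    hconv j hjn _ _ _ (hmono' a ha 0 (by omega)) (hmono' _ le_rfl a ha) hj
  obtain ⟨c, hcl, hcne⟩ : ∃ c < ℓ - 1, p^[j - 1] (x c) ≠ p^[j - 1] (x (c + 1)) := by
    by_contra hcon
    push Not at hcon
    have : ∀ a ≤ ℓ - 1, p^[j - 1] (x 0) = p^[j - 1] (x a) := by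
      intro a
      induction a with
      | zero => intro _; rfl
      | succ a ih => intro ha; rw [ih (by omega), hcon a (by omega)]
    exact hjmin (j - 1) (by omega) (this _ le_rfl)
  obtain ⟨a, b, hab, hbl, hac, hcb⟩ : ∃ a b, b + 2 * j = a + (ℓ + 1) ∧ b ≤ ℓ - 1 ∧ a ≤ c ∧
      c + 1 ≤ b := by
    refine ⟨min c (2 * j - 2), min c (2 * j - 2) + (ℓ + 1) - 2 * j, ?_, ?_, ?_, ?_⟩ <;> omega
  have hne1 : p^[j - 1] (x a) ≠ p^[j - 1] (x b) := by
    intro h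
    have h1 := hconv (j - 1) (by omega) _ (x c) _ (hmono' c (by omega) a hac)
      (hmono' b hbl c (by omega)) h
    have h2 := hconv (j - 1) (by omega) _ (x (c + 1)) _ (hmono' (c + 1) (by omega) a (by omega))
      (hmono' b hbl (c + 1) (by omega)) h
    exact hcne (h1.trans h2.symm)
  have hne : ∀ i < j, p^[i] (x a) ≠ p^[i] (x b) := by
    intro i hi h
    apply hne1
    rw [show j - 1 = (j - 1 - i) + i by omega, Function.iterate_add_apply,
      Function.iterate_add_apply, h]
  have hmeet : p^[j] (x a) = p^[j] (x b) := by rw [hall a (by omega), hall b hbl]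
  -- the cycle
  obtain ⟨L, rfl⟩ : ∃ L, b = a + L := ⟨b - a, by omega⟩
  let y : ℕ → V := fun s => if s ≤ L then x (a + s) else
    if s ≤ L + j then p^[s - L] (x (a + L)) else p^[L + 2 * j - s] (x a)
  have y1 : ∀ s ≤ L, y s = x (a + s) := fun s hs => by simp [y, hs]
  have y2 : ∀ i ≤ j, y (L + i) = p^[i] (x (a + L)) := by
    intro i hi
    rcases Nat.eq_zero_or_pos i with h | h
    · subst h; simp [y]
    · simp only [y]
      rw [if_neg (by omega), if_pos (by omega)]
      congr 2; omega
  have y3 : ∀ i ≤ j, y (L + 2 * j - i) = p^[i] (x a) := by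
    intro i hi
    rcases hi.lt_or_eq with h | h
    · simp only [y]
      rw [if_neg (by omega), if_neg (by omega)]
      congr 2; omega
    · subst h
      rw [show L + 2 * i - i = L + i by omega, y2 i le_rfl, hmeet]
  have hdist : ∀ i ≤ n, ∀ a ≤ ℓ - 1, G.dist v (p^[i] (x a)) = n - i :=
    fun i hi a ha => (hlev i hi a ha).2
  have hcase : ∀ s ≤ ℓ, (s ≤ L ∧ y s = x (a + s) ∧ G.dist v (y s) = n) ∨
      (∃ i, 1 ≤ i ∧ i ≤ j ∧ s = L + i ∧ y s = p^[i] (x (a + L)) ∧ G.dist v (y s) = n - i) ∨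
      (∃ i, 1 ≤ i ∧ i < j ∧ s = L + 2 * j - i ∧ y s = p^[i] (x a) ∧ G.dist v (y s) = n - i) := by
    intro s hs
    by_cases h1 : s ≤ L
    · left
      refine ⟨h1, y1 s h1, ?_⟩
      rw [y1 s h1]
      exact hdist 0 (by omega) (a + s) (by omega)
    · right
      by_cases h2 : s ≤ L + j
      · left
        obtain ⟨i, rfl⟩ : ∃ i, s = L + i := ⟨s - L, by omega⟩
        refine ⟨i, by omega, by omega, rfl, y2 i (by omega), ?_⟩
        rw [y2 i (by omega)]
        exact hdist i (by omega) _ hbl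
      · right
        obtain ⟨i, hi, rfl⟩ : ∃ i, i ≤ L + 2 * j ∧ s = L + 2 * j - i :=
          ⟨L + 2 * j - s, by omega, by omega⟩
        refine ⟨i, by omega, by omega, rfl, y3 i (by omega), ?_⟩
        rw [y3 i (by omega)]
        exact hdist i (by omega) _ (by omega)
  refine seq_cycle G y ℓ hℓ ?_ ?_ ?_ hc
  · intro s hs
    by_cases h1 : s < L
    · rw [y1 s h1.le, y1 (s + 1) h1]
      exact hadj (a + s) (by omega)
    · by_cases h2 : s < L + j
      · obtain ⟨i, rfl⟩ : ∃ i, s = L + i := ⟨s - L, by omega⟩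
        rw [y2 i (by omega), add_assoc, y2 (i + 1) (by omega)]
        exact hpadj i (by omega) _ hbl
      · obtain ⟨i, hi, h3⟩ : ∃ i, i + 1 ≤ j ∧ s = L + 2 * j - (i + 1) :=
          ⟨L + 2 * j - s - 1, by omega, by omega⟩
        rw [show s + 1 = L + 2 * j - i by omega, y3 i (by omega), h3, y3 (i + 1) (by omega)]
        exact (hpadj i (by omega) _ (by omega)).symm
  · have h0 : y 0 = x a := by rw [y1 0 (by omega), add_zero]
    rw [h0, show ℓ = L + 2 * j - 1 by omega, y3 1 hj1]
    exact (hpadj 0 (by omega) a (by omega)).symm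
  · intro s hs s' hs' h
    have hd := congrArg (G.dist v) h
    rcases hcase s hs with ⟨h1, h2, h3⟩ | ⟨i, hi1, hi2, h1, h2, h3⟩ | ⟨i, hi1, hi2, h1, h2, h3⟩ <;>
    rcases hcase s' hs' with ⟨h1', h2', h3'⟩ | ⟨i', hi1', hi2', h1', h2', h3'⟩ |
      ⟨i', hi1', hi2', h1', h2', h3'⟩
    · have := hxinj (a + s) (by omega) (a + s') (by omega) (by rw [← h2, ← h2', h])
      omega
    · omega
    · omega
    · omega
    · omega
    · have hii : i = i' := by omega
      subst hii
      exact absurd (by rw [← h2, ← h2', h]) (hne i hi2')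
    · omega
    · have hii : i = i' := by omega
      subst hii
      exact absurd (by rw [← h2, ← h2', h]) (hne i hi2)
    · omega

lemma layer_color {V : Type*} [Fintype V] (ℓ : ℕ) (hℓ : 2 ≤ ℓ) (G : SimpleGraph V)
    (hc : CycleLenFree G (ℓ + 1)) (v : V) (n : ℕ) (hn : n ≤ ℓ / 2) :
    ∃ col : V → ℕ, (∀ u, col u < ℓ) ∧
      ∀ u w, Lay G v n u → Lay G v n w → G.Adj u w → col u ≠ col w := by
  classical
  obtain ⟨p, hp⟩ := exists_parent G v
  obtain ⟨r, hrinj, hconv⟩ := exists_order p n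
  let P : V → ℕ → Prop := fun u k => ∃ x : ℕ → V, x k = u ∧ (∀ a ≤ k, Lay G v n (x a)) ∧
    (∀ a < k, G.Adj (x a) (x (a + 1))) ∧ ∀ a < k, r (x a) < r (x (a + 1))
  have hP0 : ∀ u, Lay G v n u → P u 0 := fun u hu =>
    ⟨fun _ => u, rfl, fun _ _ => hu, fun a h => by omega, fun a h => by omega⟩
  have hPl : ∀ u, ¬ P u (ℓ - 1) := by
    rintro u ⟨x, -, h1, h2, h3⟩
    exact no_chain ℓ hℓ G hc v p hp n hn r hconv x h1 h2 h3
  have hlt : ∀ u w, Lay G v n u → Lay G v n w → G.Adj u w → r u < r w →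
      Nat.findGreatest (P u) (ℓ - 1) < Nat.findGreatest (P w) (ℓ - 1) := by
    intro u w hu hw hadj hr
    have hk : P u (Nat.findGreatest (P u) (ℓ - 1)) :=
      Nat.findGreatest_spec (Nat.zero_le _) (hP0 u hu)
    have hle := Nat.findGreatest_le (P := P u) (ℓ - 1)
    generalize Nat.findGreatest (P u) (ℓ - 1) = k at hk hle
    have hne : k ≠ ℓ - 1 := by rintro rfl; exact hPl u hk
    apply Nat.lt_of_succ_le
    apply Nat.le_findGreatest (by omega)
    obtain ⟨x, h0, h1, h2, h3⟩ := hk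
    refine ⟨fun a => if a ≤ k then x a else w, by simp, ?_, ?_, ?_⟩
    · intro a _
      by_cases h : a ≤ k
      · simpa [h] using h1 a h
      · simpa [h] using hw
    · intro a ha
      rcases Nat.lt_succ_iff_lt_or_eq.1 ha with h | h
      · simpa [h.le, Nat.succ_le_of_lt h] using h2 a h
      · subst h; simpa [h0] using hadj
    · intro a ha
      rcases Nat.lt_succ_iff_lt_or_eq.1 ha with h | h
      · simpa [h.le, Nat.succ_le_of_lt h] using h3 a h
      · subst h; simpa [h0] using hr
  refine ⟨fun u => Nat.findGreatest (P u) (ℓ - 1), fun u => ?_, ?_⟩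
  · have := Nat.findGreatest_le (P := P u) (ℓ - 1)
    show Nat.findGreatest (P u) (ℓ - 1) < ℓ
    omega
  · intro u w hu hw hadj
    rcases lt_or_gt_of_ne (fun h => hadj.ne (hrinj h)) with h | h
    · exact (hlt u w hu hw hadj h).ne
    · exact (hlt w u hw hu hadj.symm h).ne.symm

/-- For every integer `ℓ ≥ 2` and finite `C_{ℓ+1}`-free graph `G`, with
`t = ⌊ℓ/2⌋`, every ball `B_t(v)` satisfies `χ(B_t(v)) ≤ 2ℓ`. -/
theorem cycleFree_ball_chromNum {V : Type*} [Fintype V]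
    (ℓ : ℕ) (hℓ : 2 ≤ ℓ) (G : SimpleGraph V) (hc : CycleLenFree G (ℓ + 1)) (v : V) :
    chromNum (G.induce (ballSet G v (ℓ / 2))) ≤ 2 * ℓ := by
  have key : ∀ n, ∃ col : V → ℕ, (∀ u, col u < ℓ) ∧ (n ≤ ℓ / 2 →
      ∀ u w, Lay G v n u → Lay G v n w → G.Adj u w → col u ≠ col w) := by
    intro n
    by_cases hn : n ≤ ℓ / 2
    · obtain ⟨col, h1, h2⟩ := layer_color ℓ hℓ G hc v n hn
      exact ⟨col, h1, fun _ => h2⟩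
    · exact ⟨fun _ => 0, fun _ => by show 0 < ℓ; omega, fun h => absurd h hn⟩
  choose col hcol hcol2 using key
  have hball : ∀ u ∈ ballSet G v (ℓ / 2), G.Reachable v u ∧ G.dist v u ≤ ℓ / 2 := by
    rintro u ⟨w, hw⟩
    exact ⟨w.reachable, (dist_le w).trans hw⟩
  apply Nat.sInf_le
  refine ⟨Coloring.mk (fun u => ⟨col (G.dist v u.1) u.1 + ℓ * (G.dist v u.1 % 2), ?_⟩) ?_⟩
  · have h1 := hcol (G.dist v u.1) u.1
    rcases Nat.mod_two_eq_zero_or_one (G.dist v u.1) with h | h <;> rw [h] <;> omega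
  · rintro ⟨u, hu⟩ ⟨w, hw⟩ hadj heq
    have hadj' : G.Adj u w := hadj
    obtain ⟨ru, du⟩ := hball u hu
    obtain ⟨hrw, dw⟩ := hball w hw
    have heq' : col (G.dist v u) u + ℓ * (G.dist v u % 2)
        = col (G.dist v w) w + ℓ * (G.dist v w % 2) := congrArg Fin.val heq
    have h1 := hcol (G.dist v u) u
    have h2 := hcol (G.dist v w) w
    have hd1 : G.dist v u ≤ G.dist v w + 1 := by
      obtain ⟨q, hq⟩ := hrw.exists_walk_length_eq_dist
      have := dist_le (q.concat hadj'.symm)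
      simp at this
      omega
    have hd2 : G.dist v w ≤ G.dist v u + 1 := by
      obtain ⟨q, hq⟩ := ru.exists_walk_length_eq_dist
      have := dist_le (q.concat hadj')
      simp at this
      omega
    by_cases hd : G.dist v u = G.dist v w
    · rw [hd] at heq'
      exact hcol2 (G.dist v w) dw u w ⟨ru, hd⟩ ⟨hrw, rfl⟩ hadj' (by omega)
    · rcases Nat.mod_two_eq_zero_or_one (G.dist v u) with h | h <;>
      rcases Nat.mod_two_eq_zero_or_one (G.dist v w) with h' | h' <;>
      rw [h, h'] at heq' <;> omega
end
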